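/- (Bilinear estimate in adapted atomic spaces, Proposition 5.3.) For every T > 0 there exists a constant C_T > 0 such that for all M, N, O ≥ 1, all signs σ₁, σ₂ ∈ {+1, −1}, and all frequency-localized space-time functions u at scale M (with coefficients c_m) and v at scale N (with coefficients c'_n): (i) if 4M ≤ N then ‖P_O(uv)‖_{L²([0,T] × T³)} ≤ C_T · min(O, M, N) · ‖u‖_{U²_{σ₁}} ‖v‖_{U²_{σ₂}}; (ii) if N/2 ≤ M ≤ 2N then ‖P_O(uv)‖_{L²([0,T] × T³)} ≤ C_T · max(O, M, N)^{1/2} min(O, M, N)^{1/2} · ‖u‖_{U⁴_{σ₁}} ‖v‖_{U⁴_{σ₂}}. -/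

import Mathlib

open MeasureTheory Filter
open scoped ENNReal Classical

section UpVp
variable {B : Type*} [NormedAddCommGroup B] [NormedSpace ℂ B]

/-- Extension of a function on `ℝ` to `EReal`, with value `0` at `∞`
(the convention `v(∞) = 0`). -/
noncomputable def extEReal (v : ℝ → B) : EReal → B :=
  fun x => if x = ⊤ then 0 else if x = ⊥ then 0 else v x.toReal

/-- A `U^p` atom: a step function `a(s) = ∑_{k=1}^{K} 1_{[t_{k-1}, t_k)}(s) φ_{k-1}`
associated with a partition `-∞ < t₀ < t₁ < ⋯ < t_K ≤ ∞` and values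
`φ₀, …, φ_{K-1} ∈ B` with `∑_{k} ‖φ_k‖^p = 1`. -/
noncomputable def IsUpAtom (p : ℝ) (a : ℝ → B) : Prop :=
  ∃ (K : ℕ) (t : Fin (K + 1) → EReal) (φ : Fin K → B),
    StrictMono t ∧ (∀ i, t i ≠ ⊥) ∧ (∑ k, ‖φ k‖ ^ p) = 1 ∧
    ∀ s : ℝ, a s =
      ∑ k : Fin K, if t k.castSucc ≤ (s : EReal) ∧ (s : EReal) < t k.succ then φ k else 0

/-- The `U^p` (atomic space) norm of `u : ℝ → B`: the infimum of `∑_j |λ_j|` over all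
representations `u = ∑_j λ_j a_j` (pointwise) with `(λ_j) ∈ ℓ¹(ℂ)` and `U^p` atoms `a_j`;
it equals `∞` when no such representation exists. -/
noncomputable def UpNorm (p : ℝ) (u : ℝ → B) : ℝ≥0∞ :=
  sInf { M : ℝ≥0∞ | ∃ (lam : ℕ → ℂ) (a : ℕ → ℝ → B),
    (∀ j, IsUpAtom p (a j)) ∧ Summable (fun j => ‖lam j‖) ∧
    (∀ s : ℝ, HasSum (fun j => lam j • a j s) (u s)) ∧
    M = ENNReal.ofReal (∑' j, ‖lam j‖) }

/-- The `V^p` variation norm of `v : ℝ → B`: the supremum over partitions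
`-∞ < t₀ < t₁ < ⋯ < t_K ≤ ∞` of `(∑_{i=1}^K ‖v(t_i) - v(t_{i-1})‖^p)^{1/p}`,
with the convention `v(∞) = 0`. -/
noncomputable def VpNorm (p : ℝ) (v : ℝ → B) : ℝ≥0∞ :=
  ⨆ (K : ℕ) (t : Fin (K + 1) → EReal) (_ : StrictMono t) (_ : ∀ i, t i ≠ ⊥),
    ENNReal.ofReal
      ((∑ i : Fin K, ‖extEReal v (t i.succ) - extEReal v (t i.castSucc)‖ ^ p) ^ (1 / p))

end UpVp

/-- The torus `T³`, realized as the cube `[0, 2π)³` in `ℝ³` (with Lebesgue measure). -/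
noncomputable def cube : Set (Fin 3 → ℝ) := Set.univ.pi fun _ => Set.Ico (0:ℝ) (2 * Real.pi)

/-- The Euclidean norm `|n|` of a lattice point `n ∈ ℤ³`. -/
noncomputable def normZ (n : Fin 3 → ℤ) : ℝ := Real.sqrt (∑ i, ((n i : ℝ)) ^ 2)

/-- The Japanese bracket `⟨n⟩ = (1 + |n|²)^{1/2}` of a lattice point `n ∈ ℤ³`. -/
noncomputable def jbZ (n : Fin 3 → ℤ) : ℝ := Real.sqrt (1 + ∑ i, ((n i : ℝ)) ^ 2)

/-- The Euclidean inner product `n·x` for `n ∈ ℤ³`, `x ∈ ℝ³`. -/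
noncomputable def dotZ (n : Fin 3 → ℤ) (x : Fin 3 → ℝ) : ℝ := ∑ i, (n i : ℝ) * x i

/-- The dyadic annulus `S_N = {n ∈ ℤ³ : N ≤ |n| < 2N}`, as a finite set of lattice points. -/
noncomputable def annulus (N : ℝ) : Finset (Fin 3 → ℤ) :=
  (Finset.Icc (fun _ => -⌈2 * N⌉) fun _ => ⌈2 * N⌉).filter fun n =>
    N ≤ normZ n ∧ normZ n < 2 * N

/-- The space-time function `u(t,x) = ∑_{n ∈ S} c_n(t) e^{i n·x}` with frequencies in the
finite set `S ⊂ ℤ³`. -/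
noncomputable def freqLocFun (S : Finset (Fin 3 → ℤ)) (c : (Fin 3 → ℤ) → ℝ → ℂ)
    (t : ℝ) (x : Fin 3 → ℝ) : ℂ :=
  ∑ n ∈ S, c n t * Complex.exp (Complex.I * ((dotZ n x : ℝ) : ℂ))

/-- The modulated coefficient curve `t ↦ (e^{-iσt⟨n⟩} c_n(t))_{n ∈ S}`, valued in `ℓ²(S)`.
The adapted norm `‖u‖_{U^p_σ}` (resp. `‖u‖_{V^p_σ}`) of the frequency-localized function with
coefficients `c` is `UpNorm p (modCurve S σ c)` (resp. `VpNorm p (modCurve S σ c)`). -/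
noncomputable def modCurve (S : Finset (Fin 3 → ℤ)) (σ : ℝ) (c : (Fin 3 → ℤ) → ℝ → ℂ) :
    ℝ → EuclideanSpace ℂ ↥S :=
  fun t => (WithLp.equiv 2 (↥S → ℂ)).symm
    fun n => Complex.exp (-(Complex.I * ((σ * jbZ (n : Fin 3 → ℤ) * t : ℝ) : ℂ))) *
      c (n : Fin 3 → ℤ) t

/-- The frequency projection `P_O(uv)` of the product of two frequency-localized space-time
functions `u` (scale `M`, coefficients `c`) and `v` (scale `N`, coefficients `c'`):
`P_O(uv)(t,x) = ∑_{k ∈ S_O} (∑_{m ∈ S_M, n ∈ S_N, m+n=k} c_m(t) c'_n(t)) e^{i k·x}`. -/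
noncomputable def projProd (O M N : ℝ) (c c' : (Fin 3 → ℤ) → ℝ → ℂ)
    (t : ℝ) (x : Fin 3 → ℝ) : ℂ :=
  ∑ k ∈ annulus O,
    (∑ m ∈ annulus M, ∑ n ∈ annulus N, if m + n = k then c m t * c' n t else 0) *
    Complex.exp (Complex.I * ((dotZ k x : ℝ) : ℂ))

theorem ENNReal.tsum_mul_rpow_le {p : ℝ} (hp : 1 ≤ p) (w f : ℕ → ℝ≥0∞) :
    (∑' j, w j * f j) ^ p ≤ (∑' j, w j) ^ (p - 1) * ∑' j, w j * f j ^ p := by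
  have hp0 : 0 < p := by linarith
  have h : ∑' j, w j * f j ≤ (∑' j, w j) ^ (1 - p⁻¹) * (∑' j, w j * f j ^ p) ^ p⁻¹ := by
    rw [ENNReal.tsum_eq_iSup_sum (f := fun j => w j * f j)]
    refine iSup_le fun s => (ENNReal.inner_le_weight_mul_Lp_of_nonneg s hp w f).trans ?_
    have : 0 ≤ 1 - p⁻¹ := sub_nonneg.2 (inv_le_one_of_one_le₀ hp)
    gcongr <;> exact ENNReal.sum_le_tsum s
  calc (∑' j, w j * f j) ^ p
      ≤ ((∑' j, w j) ^ (1 - p⁻¹) * (∑' j, w j * f j ^ p) ^ p⁻¹) ^ p := by gcongr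
    _ = _ := by
      rw [ENNReal.mul_rpow_of_nonneg _ _ hp0.le, ← ENNReal.rpow_mul, ← ENNReal.rpow_mul]
      congr 2
      · field_simp
      · rw [inv_mul_cancel₀ hp0.ne', ENNReal.rpow_one]

section Transfer
variable {B E : Type*} [NormedAddCommGroup B] [NormedSpace ℂ B] [NormedAddCommGroup E]
  [NormedSpace ℂ E]

/-- A function constant on time intervals of a partition inherits from constant functions an
estimate of the `L^p` norm in time. -/
theorem lintegral_map_atom_le {p : ℝ} (hp : 1 ≤ p) (μ : Measure ℝ) (L : ℝ → B →ₗ[ℂ] E)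
    (hL : ∀ φ, Measurable fun t => ‖L t φ‖ₑ) (A : ℝ≥0∞)
    (hA : ∀ φ, ∫⁻ t, ‖L t φ‖ₑ ^ p ∂μ ≤ (A * ‖φ‖ₑ) ^ p) {a : ℝ → B} (ha : IsUpAtom p a) :
    (Measurable fun t => ‖L t (a t)‖ₑ) ∧ ∫⁻ t, ‖L t (a t)‖ₑ ^ p ∂μ ≤ A ^ p := by
  have hp0 : 0 < p := by linarith
  obtain ⟨K, t, φ, ht, -, hφ, has⟩ := ha
  set I : Fin K → Set ℝ :=
    fun k => {s : ℝ | t k.castSucc ≤ (s : EReal) ∧ (s : EReal) < t k.succ} with hI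
  have hIm : ∀ k, MeasurableSet (I k) := fun k =>
    (measurableSet_le measurable_const measurable_coe_real_ereal).inter
      (measurableSet_lt measurable_coe_real_ereal measurable_const)
  have hdisj : ∀ s, ∀ k l, s ∈ I k → s ∈ I l → k = l := by
    intro s k l hk hl
    by_contra hne
    rcases lt_or_gt_of_ne hne with h | h
    · exact absurd (hk.2.trans_le ((ht.monotone (by
        rw [Fin.le_def]; simpa using h : k.succ ≤ l.castSucc)).trans hl.1)) (lt_irrefl _)
    · exact absurd (hl.2.trans_le ((ht.monotone (by
        rw [Fin.le_def]; simpa using h : l.succ ≤ k.castSucc)).trans hk.1)) (lt_irrefl _)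
  have key : ∀ (r : ℝ), 0 < r → ∀ s, ‖L s (a s)‖ₑ ^ r =
      ∑ k, (I k).indicator (fun s => ‖L s (φ k)‖ₑ ^ r) s := by
    intro r hr s
    rw [has s]
    by_cases h : ∃ k, s ∈ I k
    · obtain ⟨k, hk⟩ := h
      have hne : ∀ l, l ≠ k → s ∉ I l := fun l hl hs => hl (hdisj s l k hs hk)
      rw [Finset.sum_eq_single k, Finset.sum_eq_single k, Set.indicator_of_mem hk]
      · rw [if_pos (show _ ∧ _ from hk)]
      · intro l _ hl
        exact Set.indicator_of_notMem (hne l hl) _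
      · simp
      · intro l _ hl
        exact if_neg (hne l hl)
      · simp
    · push Not at h
      rw [Finset.sum_eq_zero, Finset.sum_eq_zero]
      · simp [hr]
      · intro l _
        exact Set.indicator_of_notMem (h l) _
      · intro l _
        exact if_neg (h l)
  constructor
  · have : (fun t => ‖L t (a t)‖ₑ) =
        fun s => ∑ k, (I k).indicator (fun s => ‖L s (φ k)‖ₑ ^ (1 : ℝ)) s := by
      funext s
      rw [← key 1 one_pos s, ENNReal.rpow_one]
    rw [this]
    exact Finset.measurable_sum _ fun k _ => ((hL (φ k)).pow_const _).indicator (hIm k)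
  · simp_rw [key p hp0]
    rw [lintegral_finsetSum _ fun k _ => ((hL (φ k)).pow_const _).indicator (hIm k)]
    calc ∑ k, ∫⁻ s, (I k).indicator (fun s => ‖L s (φ k)‖ₑ ^ p) s ∂μ
        ≤ ∑ k, A ^ p * ‖φ k‖ₑ ^ p := by
          refine Finset.sum_le_sum fun k _ => ?_
          rw [← ENNReal.mul_rpow_of_nonneg _ _ hp0.le]
          exact (lintegral_mono fun s => Set.indicator_le_self _ _ s).trans (hA (φ k))
      _ = A ^ p * ∑ k, ENNReal.ofReal (‖φ k‖ ^ p) := by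
          rw [Finset.mul_sum]
          refine Finset.sum_congr rfl fun k _ => ?_
          rw [← ENNReal.ofReal_rpow_of_nonneg (norm_nonneg _) hp0.le, ofReal_norm]
      _ = A ^ p := by
          rw [← ENNReal.ofReal_sum_of_nonneg fun k _ => by positivity, hφ]
          simp

/-- The transference principle: an `L^p` estimate in time for constant functions extends to
`U^p`. -/
theorem lintegral_map_le_UpNorm [FiniteDimensional ℂ B] {p : ℝ} (hp : 1 ≤ p) (μ : Measure ℝ)
    (L : ℝ → B →ₗ[ℂ] E) (hL : ∀ φ, Measurable fun t => ‖L t φ‖ₑ) {A : ℝ≥0∞} (hAt : A ≠ ⊤)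
    (hA : ∀ φ, ∫⁻ t, ‖L t φ‖ₑ ^ p ∂μ ≤ (A * ‖φ‖ₑ) ^ p) {w : ℝ → B} (hw : UpNorm p w ≠ ⊤) :
    ∫⁻ t, ‖L t (w t)‖ₑ ^ p ∂μ ≤ (A * UpNorm p w) ^ p := by
  have hp0 : 0 < p := by linarith
  have key : ∀ (lam : ℕ → ℂ) (a : ℕ → ℝ → B), (∀ j, IsUpAtom p (a j)) →
      Summable (fun j => ‖lam j‖) → (∀ s : ℝ, HasSum (fun j => lam j • a j s) (w s)) →
      ∫⁻ t, ‖L t (w t)‖ₑ ^ p ∂μ ≤ (A * ENNReal.ofReal (∑' j, ‖lam j‖)) ^ p := by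
    intro lam a ha hlam hsum
    have hΛ : ENNReal.ofReal (∑' j, ‖lam j‖) = ∑' j, ‖lam j‖ₑ := by
      rw [ENNReal.ofReal_tsum_of_nonneg (fun _ => norm_nonneg _) hlam]
      simp
    rw [hΛ]
    set Λ := ∑' j, ‖lam j‖ₑ
    have hpt : ∀ t, ‖L t (w t)‖ₑ ≤ ∑' j, ‖lam j‖ₑ * ‖L t (a j t)‖ₑ := by
      intro t
      have h := (hsum t).mapL (LinearMap.toContinuousLinearMap (L t))
      have h2 : HasSum (fun j => lam j • L t (a j t)) (L t (w t)) := by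
        simpa using h
      rw [← h2.tsum_eq]
      refine enorm_tsum_le_tsum_enorm.trans (le_of_eq ?_)
      simp [enorm_smul]
    calc ∫⁻ t, ‖L t (w t)‖ₑ ^ p ∂μ
        ≤ ∫⁻ t, Λ ^ (p - 1) * ∑' j, ‖lam j‖ₑ * ‖L t (a j t)‖ₑ ^ p ∂μ := by
          refine lintegral_mono fun t => ?_
          exact (ENNReal.rpow_le_rpow (hpt t) hp0.le).trans (ENNReal.tsum_mul_rpow_le hp _ _)
      _ = Λ ^ (p - 1) * ∑' j, ‖lam j‖ₑ * ∫⁻ t, ‖L t (a j t)‖ₑ ^ p ∂μ := by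
          have hm : ∀ j, Measurable fun t => ‖L t (a j t)‖ₑ ^ p := fun j =>
            ((lintegral_map_atom_le hp μ L hL A hA (ha j)).1).pow_const p
          rw [lintegral_const_mul _ (Measurable.tsum fun j => (hm j).const_mul _),
            lintegral_tsum fun j => ((hm j).const_mul _).aemeasurable]
          congr 2
          funext j
          rw [lintegral_const_mul _ (hm j)]
      _ ≤ Λ ^ (p - 1) * ∑' j, ‖lam j‖ₑ * A ^ p := by
          gcongr with j
          exact (lintegral_map_atom_le hp μ L hL A hA (ha j)).2
      _ = (A * Λ) ^ p := by
          rw [ENNReal.tsum_mul_right, ENNReal.mul_rpow_of_nonneg _ _ hp0.le, mul_comm (A ^ p),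
            ← mul_assoc]
          congr 1
          change Λ ^ (p - 1) * Λ = Λ ^ p
          conv_lhs => rw [← ENNReal.rpow_one Λ, ← ENNReal.rpow_mul, one_mul,
            ← ENNReal.rpow_add_of_nonneg _ _ (by linarith) zero_le_one]
          simp
  have hne : (A * UpNorm p w) ≠ ⊤ := ENNReal.mul_ne_top hAt hw
  by_cases hA0 : A = 0
  · rw [UpNorm] at hw
    have : ∃ M, M ∈ { M : ℝ≥0∞ | ∃ (lam : ℕ → ℂ) (a : ℕ → ℝ → B),
        (∀ j, IsUpAtom p (a j)) ∧ Summable (fun j => ‖lam j‖) ∧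
        (∀ s : ℝ, HasSum (fun j => lam j • a j s) (w s)) ∧
        M = ENNReal.ofReal (∑' j, ‖lam j‖) } := by
      by_contra! h
      rw [Set.eq_empty_of_forall_notMem h, sInf_empty] at hw
      exact hw rfl
    obtain ⟨M, lam, a, h1, h2, h3, -⟩ := this
    simpa [hA0] using key lam a h1 h2 h3
  · have h : (∫⁻ t, ‖L t (w t)‖ₑ ^ p ∂μ) ^ p⁻¹ / A ≤ UpNorm p w := by
      refine le_sInf ?_
      rintro M ⟨lam, a, h1, h2, h3, rfl⟩
      refine ENNReal.div_le_of_le_mul' ?_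
      exact (ENNReal.rpow_inv_le_iff hp0).2 (key lam a h1 h2 h3)
    rw [← ENNReal.rpow_inv_le_iff hp0]
    rwa [ENNReal.div_le_iff_le_mul (Or.inl hA0) (Or.inl hAt), mul_comm] at h

theorem eq_zero_of_UpNorm_eq_zero [FiniteDimensional ℂ B] {p : ℝ} (hp : 1 ≤ p) {w : ℝ → B}
    (hw : UpNorm p w = 0) (t : ℝ) : w t = 0 := by
  have h := lintegral_map_le_UpNorm hp (Measure.dirac t) (fun _ => (LinearMap.id : B →ₗ[ℂ] B))
    (fun φ => measurable_const) (A := 1) ENNReal.one_ne_top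
    (fun φ => by simp) (w := w) (by simp [hw])
  have hp0 : 0 < p := by linarith
  rw [lintegral_dirac] at h
  simpa [hw, hp0, ENNReal.rpow_eq_zero_iff, hp0.not_gt] using h

end Transfer

theorem integrable_exp_neg_abs_mul_cexp (ω : ℝ) :
    Integrable (fun t : ℝ => (Real.exp (-|t|) : ℂ) * Complex.exp (Complex.I * (ω * t : ℝ))) ∧
    ∫ t : ℝ, (Real.exp (-|t|) : ℂ) * Complex.exp (Complex.I * (ω * t : ℝ)) =
      ((2 / (1 + ω ^ 2) : ℝ) : ℂ) := by
  have e1 : Set.EqOn (fun t : ℝ => (Real.exp (-|t|) : ℂ) * Complex.exp (Complex.I * (ω * t : ℝ)))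
      (fun t : ℝ => Complex.exp ((1 + Complex.I * ω) * t)) (Set.Iic 0) := by
    intro t ht
    simp only [abs_of_nonpos (Set.mem_Iic.1 ht)]
    push_cast
    rw [← Complex.exp_add]
    ring_nf
  have e2 : Set.EqOn (fun t : ℝ => (Real.exp (-|t|) : ℂ) * Complex.exp (Complex.I * (ω * t : ℝ)))
      (fun t : ℝ => Complex.exp ((-1 + Complex.I * ω) * t)) (Set.Ioi 0) := by
    intro t ht
    simp only [abs_of_pos (Set.mem_Ioi.1 ht)]
    push_cast
    rw [← Complex.exp_add]
    ring_nf
  have h1 : (0 : ℝ) < (1 + Complex.I * ω : ℂ).re := by simp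
  have h2 : (-1 + Complex.I * ω : ℂ).re < 0 := by simp
  have i1 := (integrableOn_congr_fun e1 measurableSet_Iic).2 (integrableOn_exp_mul_complex_Iic h1 0)
  have i2 := (integrableOn_congr_fun e2 measurableSet_Ioi).2 (integrableOn_exp_mul_complex_Ioi h2 0)
  refine ⟨?_, ?_⟩
  · rw [← integrableOn_univ, ← Set.Iic_union_Ioi (a := (0 : ℝ))]
    exact i1.union i2
  · rw [← intervalIntegral.integral_Iic_add_Ioi i1 i2, setIntegral_congr_fun measurableSet_Iic e1,
      setIntegral_congr_fun measurableSet_Ioi e2, integral_exp_mul_complex_Iic h1,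
      integral_exp_mul_complex_Ioi h2]
    have n1 : (1 + Complex.I * ω : ℂ) ≠ 0 := fun h => by simp [h] at h1
    have n2 : (-1 + Complex.I * ω : ℂ) ≠ 0 := fun h => by simp [h] at h2
    have n3 : (1 + (ω : ℂ) ^ 2) ≠ 0 := by
      have : (1 + ω ^ 2 : ℝ) ≠ 0 := by positivity
      exact_mod_cast this
    push_cast
    simp only [mul_zero, Complex.exp_zero]
    field_simp
    linear_combination (-2 : ℂ) * Complex.I_sq * ω ^ 2

theorem inv_one_add_sq_le_floor (x : ℝ) : 1 / (1 + x ^ 2) ≤ 4 / (1 + (⌊x⌋ : ℝ) ^ 2) := by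
  have h1 := Int.floor_le x
  have h2 := Int.lt_floor_add_one x
  rw [div_le_div_iff₀ (by positivity) (by positivity)]
  rcases le_or_gt 0 ⌊x⌋ with h | h
  · have : (0 : ℝ) ≤ ⌊x⌋ := by exact_mod_cast h
    nlinarith
  · have : (⌊x⌋ : ℝ) ≤ -1 := by exact_mod_cast (by omega : ⌊x⌋ ≤ -1)
    nlinarith [sq_nonneg (3 * (⌊x⌋ : ℝ) + 4)]

theorem summable_four_div_one_add_sq : Summable fun n : ℤ => 4 / (1 + (n : ℝ) ^ 2) := by
  have h := (Real.summable_one_div_int_pow (p := 2)).2 one_lt_two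
  refine Summable.of_norm_bounded_eventually (h.mul_left 4) ?_
  filter_upwards [(Set.finite_singleton (0 : ℤ)).compl_mem_cofinite] with n hn
  have hn : (n : ℝ) ≠ 0 := by exact_mod_cast hn
  rw [Real.norm_of_nonneg (by positivity), mul_one_div]
  gcongr
  linarith

theorem sum_inv_one_add_sq_le {ι : Type*} (J : Finset ι) (ω : ι → ℝ) (K : ℕ)
    (hK : ∀ τ, (J.filter fun j => |ω j - τ| ≤ 1).card ≤ K) (τ : ℝ) :
    ∑ j ∈ J, 1 / (1 + (ω j - τ) ^ 2) ≤ (K : ℝ) * ∑' n : ℤ, 4 / (1 + (n : ℝ) ^ 2) := by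
  calc ∑ j ∈ J, 1 / (1 + (ω j - τ) ^ 2)
      ≤ ∑ j ∈ J, 4 / (1 + (⌊ω j - τ⌋ : ℝ) ^ 2) :=
        Finset.sum_le_sum fun j _ => inv_one_add_sq_le_floor _
    _ = ∑ n ∈ J.image (fun j => ⌊ω j - τ⌋),
          ((J.filter fun j => ⌊ω j - τ⌋ = n).card : ℝ) * (4 / (1 + (n : ℝ) ^ 2)) := by
        rw [Finset.sum_comp (fun n : ℤ => 4 / (1 + (n : ℝ) ^ 2)) (fun j => ⌊ω j - τ⌋)]
        simp only [nsmul_eq_mul]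
    _ ≤ ∑ n ∈ J.image (fun j => ⌊ω j - τ⌋), (K : ℝ) * (4 / (1 + (n : ℝ) ^ 2)) := by
        refine Finset.sum_le_sum fun n _ => ?_
        gcongr
        refine (Finset.card_le_card ?_).trans (hK (τ + n + 1 / 2))
        intro j hj
        rw [Finset.mem_filter] at hj ⊢
        refine ⟨hj.1, ?_⟩
        have h1 := Int.floor_le (ω j - τ)
        have h2 := Int.lt_floor_add_one (ω j - τ)
        rw [hj.2] at h1 h2
        rw [abs_le]
        constructor <;> linarith
    _ ≤ K * ∑' n : ℤ, 4 / (1 + (n : ℝ) ^ 2) := by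
        rw [← Finset.mul_sum]
        gcongr
        exact summable_four_div_one_add_sq.sum_le_tsum _ fun n _ => by positivity

/-- Local-in-time almost orthogonality of exponentials: if at most `K` of the frequencies lie in
any interval of length two, the square integral is bounded by `K` times the sum of squares. -/
theorem exists_lintegral_expSum_le (T : ℝ) : ∃ C > (0 : ℝ), ∀ {ι : Type} (J : Finset ι)
    (α : ι → ℂ) (ω : ι → ℝ) (K : ℕ), (∀ τ, (J.filter fun j => |ω j - τ| ≤ 1).card ≤ K) →
    ∫⁻ t in Set.Icc 0 T, ‖∑ j ∈ J, α j * Complex.exp (Complex.I * (ω j * t : ℝ))‖ₑ ^ 2 ≤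
      ENNReal.ofReal (C * K * ∑ j ∈ J, ‖α j‖ ^ 2) := by
  set S := ∑' n : ℤ, 4 / (1 + (n : ℝ) ^ 2) with hS
  have hSpos : 0 < S := by
    have := summable_four_div_one_add_sq.le_tsum 0 fun n _ => by positivity
    norm_num at this
    linarith
  refine ⟨Real.exp T * (2 * S), by positivity, ?_⟩
  intro ι J α ω K hK
  set f : ℝ → ℂ := fun t => ∑ j ∈ J, α j * Complex.exp (Complex.I * (ω j * t : ℝ)) with hf
  have hexp : ∀ t, ((Real.exp (-|t|) * ‖f t‖ ^ 2 : ℝ) : ℂ) = ∑ j ∈ J, ∑ l ∈ J,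
      (α j * (starRingEnd ℂ) (α l)) *
        ((Real.exp (-|t|) : ℂ) * Complex.exp (Complex.I * ((ω j - ω l) * t : ℝ))) := by
    intro t
    have : ((‖f t‖ ^ 2 : ℝ) : ℂ) = f t * (starRingEnd ℂ) (f t) := by
      rw [Complex.mul_conj, Complex.normSq_eq_norm_sq]
    rw [Complex.ofReal_mul, this, hf]
    simp only
    rw [map_sum, Finset.sum_mul_sum, Finset.mul_sum]
    refine Finset.sum_congr rfl fun j _ => ?_
    rw [Finset.mul_sum]
    refine Finset.sum_congr rfl fun l _ => ?_
    rw [map_mul, ← Complex.exp_conj, map_mul, Complex.conj_I, Complex.conj_ofReal]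
    have : Complex.exp (Complex.I * ((ω j - ω l) * t : ℝ)) =
        Complex.exp (Complex.I * (ω j * t : ℝ)) * Complex.exp (-Complex.I * (ω l * t : ℝ)) := by
      rw [← Complex.exp_add]
      congr 1
      push_cast
      ring
    rw [this]
    ring
  have hint : Integrable fun t => ((Real.exp (-|t|) * ‖f t‖ ^ 2 : ℝ) : ℂ) := by
    simp_rw [hexp]
    refine integrable_finsetSum _ fun j _ => integrable_finsetSum _ fun l _ => ?_
    exact (integrable_exp_neg_abs_mul_cexp (ω j - ω l)).1.const_mul _
  have hintR : Integrable fun t => Real.exp (-|t|) * ‖f t‖ ^ 2 := by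
    exact hint.re
  have hval : ((∫ t, Real.exp (-|t|) * ‖f t‖ ^ 2 : ℝ) : ℂ) = ∑ j ∈ J, ∑ l ∈ J,
      (α j * (starRingEnd ℂ) (α l)) * ((2 / (1 + (ω j - ω l) ^ 2) : ℝ) : ℂ) := by
    rw [← integral_complex_ofReal]
    simp_rw [hexp]
    rw [integral_finsetSum _ fun j _ => integrable_finsetSum _ fun l _ =>
      (integrable_exp_neg_abs_mul_cexp (ω j - ω l)).1.const_mul _]
    refine Finset.sum_congr rfl fun j _ => ?_
    rw [integral_finsetSum _ fun l _ =>
      (integrable_exp_neg_abs_mul_cexp (ω j - ω l)).1.const_mul _]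
    refine Finset.sum_congr rfl fun l _ => ?_
    rw [integral_const_mul, (integrable_exp_neg_abs_mul_cexp (ω j - ω l)).2]
  have hbound : ∫ t, Real.exp (-|t|) * ‖f t‖ ^ 2 ≤ 2 * S * K * ∑ j ∈ J, ‖α j‖ ^ 2 := by
    have h0 : 0 ≤ ∫ t, Real.exp (-|t|) * ‖f t‖ ^ 2 := integral_nonneg fun t => by positivity
    calc ∫ t, Real.exp (-|t|) * ‖f t‖ ^ 2
        = ‖((∫ t, Real.exp (-|t|) * ‖f t‖ ^ 2 : ℝ) : ℂ)‖ := by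
          rw [Complex.norm_of_nonneg h0]
      _ ≤ ∑ j ∈ J, ∑ l ∈ J, (‖α j‖ ^ 2 + ‖α l‖ ^ 2) * (1 / (1 + (ω j - ω l) ^ 2)) := by
          rw [hval]
          refine (norm_sum_le _ _).trans (Finset.sum_le_sum fun j _ =>
            (norm_sum_le _ _).trans (Finset.sum_le_sum fun l _ => ?_))
          rw [norm_mul, norm_mul, RCLike.norm_conj, Complex.norm_of_nonneg (by positivity),
            div_eq_mul_one_div, ← mul_assoc]
          gcongr
          nlinarith [sq_nonneg (‖α j‖ - ‖α l‖)]
      _ = ∑ j ∈ J, ‖α j‖ ^ 2 * ∑ l ∈ J, 1 / (1 + (ω l - ω j) ^ 2) +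
            ∑ l ∈ J, ‖α l‖ ^ 2 * ∑ j ∈ J, 1 / (1 + (ω j - ω l) ^ 2) := by
          simp_rw [add_mul, Finset.sum_add_distrib, Finset.mul_sum]
          congr 1
          · refine Finset.sum_congr rfl fun j _ => Finset.sum_congr rfl fun l _ => ?_
            rw [show (ω j - ω l) ^ 2 = (ω l - ω j) ^ 2 by ring]
          · rw [Finset.sum_comm]
      _ ≤ ∑ j ∈ J, ‖α j‖ ^ 2 * (K * S) + ∑ l ∈ J, ‖α l‖ ^ 2 * (K * S) := by
          gcongr <;> exact sum_inv_one_add_sq_le J ω K hK _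
      _ = 2 * S * K * ∑ j ∈ J, ‖α j‖ ^ 2 := by
          rw [← Finset.sum_mul]
          ring
  calc ∫⁻ t in Set.Icc 0 T, ‖f t‖ₑ ^ 2
      ≤ ∫⁻ t in Set.Icc 0 T, ENNReal.ofReal (Real.exp T * (Real.exp (-|t|) * ‖f t‖ ^ 2)) := by
        refine setLIntegral_mono' measurableSet_Icc fun t ht => ?_
        rw [← ofReal_norm, ← ENNReal.ofReal_pow (norm_nonneg _)]
        refine ENNReal.ofReal_le_ofReal ?_
        rw [← mul_assoc, ← Real.exp_add, abs_of_nonneg ht.1]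
        exact le_mul_of_one_le_left (by positivity) (Real.one_le_exp (by linarith [ht.2]))
    _ ≤ ∫⁻ t, ENNReal.ofReal (Real.exp T * (Real.exp (-|t|) * ‖f t‖ ^ 2)) :=
        setLIntegral_le_lintegral _ _
    _ = ENNReal.ofReal (∫ t, Real.exp T * (Real.exp (-|t|) * ‖f t‖ ^ 2)) := by
        rw [ofReal_integral_eq_lintegral_ofReal (hintR.const_mul _)]
        exact Eventually.of_forall fun t => by positivity
    _ ≤ _ := by
        refine ENNReal.ofReal_le_ofReal ?_
        rw [integral_const_mul]
        calc Real.exp T * ∫ t, Real.exp (-|t|) * ‖f t‖ ^ 2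
            ≤ Real.exp T * (2 * S * K * ∑ j ∈ J, ‖α j‖ ^ 2) := by gcongr
          _ = _ := by ring

theorem volume_planar_annulus_le (b : ℝ) {L : ℝ} (hL : 0 ≤ L) :
    volume {z : Fin 2 → ℝ | b ≤ ∑ i, z i ^ 2 ∧ ∑ i, z i ^ 2 ≤ b + L} ≤
      ENNReal.ofReal (Real.pi * L) := by
  have hm : MeasurableSet {z : Fin 2 → ℝ | b ≤ ∑ i, z i ^ 2 ∧ ∑ i, z i ^ 2 ≤ b + L} := by
    measurability
  rw [← (PiLp.volume_preserving_ofLp (Fin 2)).measure_preimage hm.nullMeasurableSet]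
  have hsub : WithLp.ofLp ⁻¹' {z : Fin 2 → ℝ | b ≤ ∑ i, z i ^ 2 ∧ ∑ i, z i ^ 2 ≤ b + L} ⊆
      Metric.closedBall (0 : EuclideanSpace ℝ (Fin 2)) (√(b + L)) \ Metric.ball 0 (√b) := by
    intro z hz
    have hn : ‖z‖ ^ 2 = ∑ i, z i ^ 2 := by simp [EuclideanSpace.norm_sq_eq]
    obtain ⟨h1, h2⟩ := hz
    rw [← hn] at h1 h2
    simp only [Set.mem_sdiff, Metric.mem_closedBall, Metric.mem_ball, dist_zero_right, not_lt]
    exact ⟨Real.le_sqrt_of_sq_le h2, Real.sqrt_le_iff.2 ⟨norm_nonneg _, h1⟩⟩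
  refine (measure_mono hsub).trans ?_
  rw [measure_sdiff ((Metric.ball_subset_closedBall).trans
    (Metric.closedBall_subset_closedBall (Real.sqrt_le_sqrt (by linarith))))
    measurableSet_ball.nullMeasurableSet measure_ball_lt_top.ne,
    EuclideanSpace.volume_closedBall_fin_two, EuclideanSpace.volume_ball_fin_two,
    ← ENNReal.ofReal_pow (Real.sqrt_nonneg _), ← ENNReal.ofReal_pow (Real.sqrt_nonneg _),
    ← ENNReal.ofReal_mul (by positivity), ← ENNReal.ofReal_mul (by positivity),
    ← ENNReal.ofReal_sub _ (by positivity)]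
  refine ENNReal.ofReal_le_ofReal ?_
  rw [← sub_mul, mul_comm]
  gcongr
  rcases le_or_gt 0 b with hb | hb
  · rw [Real.sq_sqrt hb, Real.sq_sqrt (by linarith)]
    linarith
  · rw [Real.sqrt_eq_zero_of_nonpos hb.le]
    rcases le_or_gt 0 (b + L) with hb' | hb'
    · rw [Real.sq_sqrt hb']
      linarith
    · rw [Real.sqrt_eq_zero_of_nonpos hb'.le]
      simpa using hL

theorem volume_coordinate_zone_le (a h b : ℝ) {L : ℝ} (hL : 0 ≤ L) :
    volume {x : Fin 3 → ℝ | (a ≤ x 0 ∧ x 0 ≤ a + h) ∧ b ≤ ∑ i, x i ^ 2 ∧ ∑ i, x i ^ 2 ≤ b + L} ≤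
      ENNReal.ofReal h * ENNReal.ofReal (Real.pi * L) := by
  set Z := {x : Fin 3 → ℝ | (a ≤ x 0 ∧ x 0 ≤ a + h) ∧ b ≤ ∑ i, x i ^ 2 ∧ ∑ i, x i ^ 2 ≤ b + L}
    with hZ
  have hm : MeasurableSet Z := by
    measurability
  have hp := (volume_preserving_piFinSuccAbove (fun _ : Fin 3 => ℝ) 0).symm
  rw [← hp.measure_preimage hm.nullMeasurableSet, Measure.volume_eq_prod,
    Measure.prod_apply ((MeasurableEquiv.measurable _) hm)]
  calc _ ≤ ∫⁻ s, (Set.Icc a (a + h)).indicator (fun _ => ENNReal.ofReal (Real.pi * L)) s := by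
        refine lintegral_mono fun s => ?_
        by_cases hs : s ∈ Set.Icc a (a + h)
        · rw [Set.indicator_of_mem hs]
          refine (measure_mono ?_).trans (volume_planar_annulus_le (b - s ^ 2) hL)
          intro z hz
          obtain ⟨-, h1, h2⟩ := hz
          simp only [Fin.sum_univ_three, Fin.sum_univ_two, Set.mem_ofPred_eq] at h1 h2 ⊢
          change b ≤ s ^ 2 + z 0 ^ 2 + z 1 ^ 2 at h1
          change s ^ 2 + z 0 ^ 2 + z 1 ^ 2 ≤ b + L at h2
          constructor <;> linarith
        · rw [Set.indicator_of_notMem hs, nonpos_iff_eq_zero]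
          convert measure_empty (μ := (volume : Measure (Fin 2 → ℝ)))
          refine Set.eq_empty_of_forall_notMem fun z hz => hs ?_
          exact hz.1
    _ = _ := by
        rw [lintegral_indicator measurableSet_Icc, setLIntegral_const, Real.volume_Icc, mul_comm]
        simp

/-- A slab of width `h` meets a spherical shell `b ≤ |x|² ≤ b + L` of `ℝ³` in a set of volume at
most `π h L`. -/
theorem volume_zone_le {e : EuclideanSpace ℝ (Fin 3)} (he : ‖e‖ = 1) (a h b : ℝ) {L : ℝ}
    (hL : 0 ≤ L) :
    volume {x : EuclideanSpace ℝ (Fin 3) | (a ≤ inner ℝ e x ∧ inner ℝ e x ≤ a + h) ∧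
      b ≤ ‖x‖ ^ 2 ∧ ‖x‖ ^ 2 ≤ b + L} ≤ ENNReal.ofReal h * ENNReal.ofReal (Real.pi * L) := by
  obtain ⟨B, hB⟩ := Orthonormal.exists_orthonormalBasis_extension_of_card_eq (𝕜 := ℝ)
    (E := EuclideanSpace ℝ (Fin 3)) (ι := Fin 3) (by simp) (v := fun _ => e) (s := {0}) (by
      constructor
      · intro i
        simpa using he
      · intro i j hij
        exact absurd (Subsingleton.elim i j) hij)
  have hB0 : B 0 = e := hB 0 rfl
  refine le_trans (le_of_eq ?_) (volume_coordinate_zone_le a h b hL)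
  have hm : MeasurableSet {x : Fin 3 → ℝ | (a ≤ x 0 ∧ x 0 ≤ a + h) ∧
      b ≤ ∑ i, x i ^ 2 ∧ ∑ i, x i ^ 2 ≤ b + L} := by
    measurability
  rw [← ((PiLp.volume_preserving_ofLp (Fin 3)).comp B.measurePreserving_repr).measure_preimage
    hm.nullMeasurableSet]
  congr 1
  ext x
  have hn : ‖x‖ ^ 2 = ∑ i, (B.repr x) i ^ 2 := by
    rw [← B.repr.norm_map x, EuclideanSpace.norm_sq_eq]
    simp
  have h0 : (B.repr x) 0 = inner ℝ e x := by rw [B.repr_apply_apply, hB0]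
  simp only [Set.mem_ofPred_eq, Set.mem_preimage, Function.comp_apply, ← hn, h0]

/-- The lattice point `n` as a vector of Euclidean space. -/
noncomputable def latticeVec (n : Fin 3 → ℤ) : EuclideanSpace ℝ (Fin 3) :=
  WithLp.toLp 2 fun i => (n i : ℝ)

theorem norm_latticeVec (n : Fin 3 → ℤ) : ‖latticeVec n‖ = normZ n := by
  simp [latticeVec, normZ, EuclideanSpace.norm_eq]

theorem latticeVec_sub (m n : Fin 3 → ℤ) :
    latticeVec (m - n) = latticeVec m - latticeVec n := by
  ext i
  simp [latticeVec]

theorem latticeVec_add (m n : Fin 3 → ℤ) :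
    latticeVec (m + n) = latticeVec m + latticeVec n := by
  ext i
  simp [latticeVec]

/-- If the unit cubes attached to finitely many lattice points lie in `Z`, their number is at most
the volume of `Z`. -/
theorem card_le_volume (F : Finset (Fin 3 → ℤ)) (Z : Set (EuclideanSpace ℝ (Fin 3)))
    (hF : ∀ m ∈ F, ∀ x, ‖x - latticeVec m‖ ≤ 2 → x ∈ Z) : (F.card : ℝ≥0∞) ≤ volume Z := by
  set Q : (Fin 3 → ℤ) → Set (EuclideanSpace ℝ (Fin 3)) := fun m =>
    WithLp.ofLp ⁻¹' (Set.univ.pi fun i => Set.Ico (m i : ℝ) (m i + 1)) with hQ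
  have hQm : ∀ m : Fin 3 → ℤ,
      MeasurableSet (Set.univ.pi fun i : Fin 3 => Set.Ico (m i : ℝ) (m i + 1)) :=
    fun m => MeasurableSet.univ_pi fun i => measurableSet_Ico
  have hv : ∀ m : Fin 3 → ℤ, volume (Q m) = 1 := by
    intro m
    rw [hQ, (PiLp.volume_preserving_ofLp (Fin 3)).measure_preimage (hQm m).nullMeasurableSet,
      Real.volume_pi_Ico]
    simp
  have hdisj : (F : Set (Fin 3 → ℤ)).PairwiseDisjoint Q := by
    intro m _ n _ hmn
    refine Set.disjoint_left.2 fun x hm hn => hmn ?_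
    funext i
    have h1 := hm i trivial
    have h2 := hn i trivial
    have e1 := Int.floor_eq_iff.2 ⟨h1.1, h1.2⟩
    have e2 := Int.floor_eq_iff.2 ⟨h2.1, h2.2⟩
    rw [← e1, ← e2]
  have hsub : (⋃ m ∈ F, Q m) ⊆ Z := by
    intro x hx
    simp only [Set.mem_iUnion] at hx
    obtain ⟨m, hm, hx⟩ := hx
    refine hF m hm x ?_
    rw [← sq_le_sq₀ (norm_nonneg _) (by norm_num), EuclideanSpace.norm_sq_eq]
    calc ∑ i, ‖(x - latticeVec m) i‖ ^ 2 ≤ ∑ i : Fin 3, (1 : ℝ) := by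
          refine Finset.sum_le_sum fun i _ => ?_
          have h := hx i trivial
          rw [Real.norm_eq_abs, sq_abs]
          change (x i - (m i : ℝ)) ^ 2 ≤ 1
          nlinarith [h.1, h.2]
      _ ≤ 2 ^ 2 := by norm_num
  refine le_trans (le_of_eq ?_) (measure_mono hsub)
  rw [measure_biUnion_finset hdisj fun m _ => (PiLp.volume_preserving_ofLp (Fin 3)).measurable
    (hQm m)]
  simp [hv]

theorem jbZ_sq (n : Fin 3 → ℤ) : jbZ n ^ 2 = 1 + ‖latticeVec n‖ ^ 2 := by
  rw [norm_latticeVec, jbZ, normZ, Real.sq_sqrt (by positivity), Real.sq_sqrt (by positivity)]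

theorem jbZ_nonneg (n : Fin 3 → ℤ) : 0 ≤ jbZ n := Real.sqrt_nonneg _

theorem norm_latticeVec_le_jbZ (n : Fin 3 → ℤ) : ‖latticeVec n‖ ≤ jbZ n := by
  nlinarith [jbZ_sq n, jbZ_nonneg n, norm_nonneg (latticeVec n)]

theorem jbZ_le_norm_latticeVec_add_one (n : Fin 3 → ℤ) : jbZ n ≤ ‖latticeVec n‖ + 1 := by
  nlinarith [jbZ_sq n, jbZ_nonneg n, norm_nonneg (latticeVec n)]

theorem jbZ_sub_jbZ_le (m n : Fin 3 → ℤ) : jbZ m - jbZ n ≤ ‖latticeVec m - latticeVec n‖ := by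
  have h := norm_sub_norm_le (latticeVec m) (latticeVec n)
  have h0 := norm_nonneg (latticeVec m - latticeVec n)
  by_contra! hlt
  have hm := jbZ_sq m
  have hn := jbZ_sq n
  have hn' := norm_latticeVec_le_jbZ n
  have := norm_nonneg (latticeVec m)
  have := norm_nonneg (latticeVec n)
  have h1 : ‖latticeVec m‖ ^ 2 ≤ (‖latticeVec n‖ + ‖latticeVec m - latticeVec n‖) ^ 2 := by
    gcongr
    linarith
  have h2 : (jbZ n + ‖latticeVec m - latticeVec n‖) ^ 2 < jbZ m ^ 2 := by
    have := jbZ_nonneg n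
    gcongr
    linarith
  nlinarith

theorem abs_jbZ_sub_jbZ_le (m n : Fin 3 → ℤ) :
    |jbZ m - jbZ n| ≤ ‖latticeVec m - latticeVec n‖ := by
  rw [abs_le]
  have h1 := jbZ_sub_jbZ_le m n
  have h2 := jbZ_sub_jbZ_le n m
  rw [norm_sub_rev] at h2
  constructor <;> linarith

/-- The number of lattice points at distance `p + O(1)` from the origin inside a slab of width
`O(h)` is `O(h p)`. -/
theorem card_zone_le (F : Finset (Fin 3 → ℤ)) {k : EuclideanSpace ℝ (Fin 3)} (hk : k ≠ 0)
    {p h : ℝ} (hp : 1 ≤ p) (hh : 0 ≤ h) (hF : ∀ m ∈ F, |jbZ m - p| ≤ 1)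
    (hslab : ∀ m ∈ F, ∀ m' ∈ F, |inner ℝ k (latticeVec m - latticeVec m')| ≤ h * ‖k‖) :
    (F.card : ℝ) ≤ 256 * (h + 1) * p := by
  rcases F.eq_empty_or_nonempty with rfl | ⟨m₀, hm₀⟩
  · simp only [Finset.card_empty, Nat.cast_zero]
    positivity
  have hk0 : 0 < ‖k‖ := norm_pos_iff.2 hk
  set e : EuclideanSpace ℝ (Fin 3) := (‖k‖⁻¹ : ℝ) • k with he
  have he1 : ‖e‖ = 1 := by
    rw [he, norm_smul, norm_inv, norm_norm, inv_mul_cancel₀ hk0.ne']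
  set s := inner ℝ e (latticeVec m₀) with hs
  set b := (max (p - 4) 0) ^ 2 with hb
  have hvol := volume_zone_le he1 (s - (h + 2)) (2 * (h + 2)) b (L := 16 * p) (by positivity)
  have hcard := (card_le_volume F _ ?_).trans hvol
  · rw [← ENNReal.ofReal_mul (by positivity), ← ENNReal.ofReal_natCast,
      ENNReal.ofReal_le_ofReal_iff (by positivity)] at hcard
    refine hcard.trans ?_
    have := Real.pi_lt_four
    calc 2 * (h + 2) * (Real.pi * (16 * p)) ≤ 4 * (h + 1) * (4 * (16 * p)) := by
          refine mul_le_mul (by linarith) ?_ (by positivity) (by positivity)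
          gcongr
      _ = 256 * (h + 1) * p := by ring
  · intro m hm x hx
    have h1 := abs_le.1 (hF m hm)
    have h2 := norm_latticeVec_le_jbZ m
    have h3 := jbZ_le_norm_latticeVec_add_one m
    have h4 := norm_sub_norm_le x (latticeVec m)
    have h5 := norm_sub_norm_le (latticeVec m) x
    rw [norm_sub_rev] at h5
    have hup : ‖x‖ ≤ p + 3 := by linarith
    have hlo : max (p - 4) 0 ≤ ‖x‖ := max_le (by linarith) (norm_nonneg _)
    refine ⟨?_, pow_le_pow_left₀ (le_max_right _ _) hlo 2, ?_⟩
    · have hsplit : inner ℝ e x = inner ℝ e (x - latticeVec m) +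
          inner ℝ e (latticeVec m - latticeVec m₀) + s := by
        rw [hs, inner_sub_right, inner_sub_right]
        ring
      have ha : |inner ℝ e (x - latticeVec m)| ≤ 2 := by
        refine (abs_real_inner_le_norm _ _).trans ?_
        rw [he1, one_mul]
        exact hx
      have hb : |inner ℝ e (latticeVec m - latticeVec m₀)| ≤ h := by
        rw [he, real_inner_smul_left, abs_mul, abs_inv, abs_norm, inv_mul_le_iff₀ hk0, mul_comm]
        exact hslab m hm m₀ hm₀
      rw [abs_le] at ha hb
      rw [hsplit]
      constructor <;> linarith
    · refine (pow_le_pow_left₀ (norm_nonneg _) hup 2).trans ?_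
      rcases le_total (p - 4) 0 with h | h
      · rw [hb, max_eq_right h]
        nlinarith
      · rw [hb, max_eq_left h]
        nlinarith

theorem card_le_of_fiber_le {ι : Type*} (F : Finset ι) (f : ι → ℝ) {a w A : ℝ} (hA : 0 ≤ A)
    (hw : 0 ≤ w) (hf : ∀ m ∈ F, a ≤ f m ∧ f m ≤ a + w)
    (hfib : ∀ p : ℤ, ((F.filter fun m => ⌊f m⌋ = p).card : ℝ) ≤ A) :
    (F.card : ℝ) ≤ A * (w + 2) := by
  have h1 := Finset.card_le_mul_card_image (f := fun m => ⌊f m⌋) F ⌊A⌋₊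
    fun p _ => Nat.le_floor (hfib p)
  have h2 : F.image (fun m => ⌊f m⌋) ⊆ Finset.Icc ⌊a⌋ ⌊a + w⌋ := by
    intro p hp
    obtain ⟨m, hm, rfl⟩ := Finset.mem_image.1 hp
    exact Finset.mem_Icc.2 ⟨Int.floor_le_floor (hf m hm).1, Int.floor_le_floor (hf m hm).2⟩
  have h3 : ((F.image (fun m => ⌊f m⌋)).card : ℝ) ≤ w + 2 := by
    refine (Nat.cast_le.2 (Finset.card_le_card h2)).trans ?_
    rw [Int.card_Icc]
    have hle : ⌊a⌋ ≤ ⌊a + w⌋ := Int.floor_le_floor (by linarith)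
    have : (((⌊a + w⌋ + 1 - ⌊a⌋).toNat : ℤ) : ℝ) = ((⌊a + w⌋ + 1 - ⌊a⌋ : ℤ) : ℝ) := by
      rw [Int.toNat_of_nonneg (by omega)]
    rw [Int.cast_natCast] at this
    rw [this]
    push_cast
    linarith [Int.floor_le (a + w), Int.lt_floor_add_one a]
  calc (F.card : ℝ) ≤ (⌊A⌋₊ : ℝ) * (F.image (fun m => ⌊f m⌋)).card := by exact_mod_cast h1
    _ ≤ A * (w + 2) := by
      gcongr
      exact Nat.floor_le hA

/-- Number of lattice points in the intersection of a family of pairs of unit-width shells centred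
at `0` and `k`. -/
theorem card_resonant_le (F : Finset (Fin 3 → ℤ)) (k : Fin 3 → ℤ) {σ₁ σ₂ τ a w P R : ℝ}
    (hσ₁ : σ₁ = 1 ∨ σ₁ = -1) (hσ₂ : σ₂ = 1 ∨ σ₂ = -1) (hw : 0 ≤ w) (hR : 0 < R) (hP : 1 ≤ P)
    (hPR : P ≤ R) (hk : R ≤ 6 * ‖latticeVec k‖)
    (hF : ∀ m ∈ F, (a ≤ jbZ m ∧ jbZ m ≤ a + w) ∧ jbZ m ≤ P ∧ jbZ (k - m) ≤ R ∧
      |σ₁ * jbZ m + σ₂ * jbZ (k - m) - τ| ≤ 1) :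
    (F.card : ℝ) ≤ 6400 * P * (w + 2) := by
  have hk0 : latticeVec k ≠ 0 := by
    intro h
    rw [h, norm_zero] at hk
    linarith
  refine card_le_of_fiber_le F jbZ (by positivity) hw (fun m hm => (hF m hm).1) fun p => ?_
  have hfl : ∀ m ∈ F.filter (fun m => ⌊jbZ m⌋ = p), (p : ℝ) ≤ jbZ m ∧ jbZ m < p + 1 := by
    intro m hm
    rw [← (Finset.mem_filter.1 hm).2]
    exact ⟨Int.floor_le _, Int.lt_floor_add_one _⟩
  rcases (F.filter fun m => ⌊jbZ m⌋ = p).eq_empty_or_nonempty with h0 | ⟨m₀, hm₀⟩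
  · rw [h0]
    simp only [Finset.card_empty, Nat.cast_zero]
    positivity
  have hpP : (p : ℝ) ≤ P := (hfl m₀ hm₀).1.trans (hF m₀ (Finset.mem_filter.1 hm₀).1).2.1
  have hp1 : (1 : ℝ) ≤ p := by
    have : (1 : ℝ) ≤ jbZ m₀ := by
      have := jbZ_sq m₀
      nlinarith [jbZ_nonneg m₀, sq_nonneg ‖latticeVec m₀‖]
    have h : (0 : ℝ) < p := by linarith [(hfl m₀ hm₀).2]
    exact_mod_cast (by exact_mod_cast h : (0 : ℤ) < p)
  have hz := card_zone_le (F.filter fun m => ⌊jbZ m⌋ = p) hk0 hp1 (h := 24) (by norm_num) ?_ ?_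
  · refine hz.trans ?_
    nlinarith
  · intro m hm
    have := hfl m hm
    rw [abs_le]
    constructor <;> linarith
  · intro m hm m' hm'
    obtain ⟨-, hmP, hmR, hmτ⟩ := hF m (Finset.mem_filter.1 hm).1
    obtain ⟨-, hmP', hmR', hmτ'⟩ := hF m' (Finset.mem_filter.1 hm').1
    have hf := hfl m hm
    have hf' := hfl m' hm'
    have n1 := jbZ_nonneg m
    have n2 := jbZ_nonneg m'
    have n3 := jbZ_nonneg (k - m)
    have n4 := jbZ_nonneg (k - m')
    have hid : 2 * inner ℝ (latticeVec k) (latticeVec m - latticeVec m') =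
        (jbZ m ^ 2 - jbZ m' ^ 2) - (jbZ (k - m) ^ 2 - jbZ (k - m') ^ 2) := by
      rw [jbZ_sq, jbZ_sq, jbZ_sq, jbZ_sq, latticeVec_sub, latticeVec_sub, norm_sub_sq_real,
        norm_sub_sq_real, inner_sub_right]
      ring
    have hdP : |jbZ m - jbZ m'| ≤ 1 := by
      rw [abs_le]
      constructor <;> linarith
    have hdR : |jbZ (k - m) - jbZ (k - m')| ≤ 3 := by
      rw [abs_le] at hmτ hmτ' hdP ⊢
      rcases hσ₁ with rfl | rfl <;> rcases hσ₂ with rfl | rfl <;> constructor <;> linarith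
    have e1 : |jbZ m ^ 2 - jbZ m' ^ 2| ≤ 1 * (2 * R) := by
      rw [show jbZ m ^ 2 - jbZ m' ^ 2 = (jbZ m - jbZ m') * (jbZ m + jbZ m') by ring, abs_mul,
        abs_of_nonneg (add_nonneg n1 n2)]
      gcongr
      linarith
    have e2 : |jbZ (k - m) ^ 2 - jbZ (k - m') ^ 2| ≤ 3 * (2 * R) := by
      rw [show jbZ (k - m) ^ 2 - jbZ (k - m') ^ 2 =
        (jbZ (k - m) - jbZ (k - m')) * (jbZ (k - m) + jbZ (k - m')) by ring, abs_mul,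
        abs_of_nonneg (add_nonneg n3 n4)]
      gcongr
      linarith
    have e3 := (abs_sub _ _).trans (add_le_add e1 e2)
    rw [← hid, abs_mul, abs_two] at e3
    linarith

theorem mem_annulus_iff {N : ℝ} {n : Fin 3 → ℤ} (hn : n ∈ annulus N) :
    N ≤ ‖latticeVec n‖ ∧ ‖latticeVec n‖ < 2 * N := by
  rw [norm_latticeVec]
  exact (Finset.mem_filter.1 hn).2

/-- Resonance count for separated frequency scales. -/
theorem card_resonant_separated_le {M N : ℝ} (hM : 1 ≤ M) (hMN : 4 * M ≤ N) {σ₁ σ₂ : ℝ}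
    (hσ₁ : σ₁ = 1 ∨ σ₁ = -1) (hσ₂ : σ₂ = 1 ∨ σ₂ = -1) (k : Fin 3 → ℤ) (τ : ℝ) :
    (((annulus M).filter fun m => k - m ∈ annulus N ∧
      |σ₁ * jbZ m + σ₂ * jbZ (k - m) - τ| ≤ 1).card : ℝ) ≤ 76800 * M ^ 2 := by
  set F := (annulus M).filter fun m => k - m ∈ annulus N ∧
      |σ₁ * jbZ m + σ₂ * jbZ (k - m) - τ| ≤ 1 with hF
  rcases F.eq_empty_or_nonempty with h0 | ⟨m₀, hm₀⟩
  · rw [h0]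
    simp only [Finset.card_empty, Nat.cast_zero]
    positivity
  have hk : 3 * N ≤ 6 * ‖latticeVec k‖ := by
    obtain ⟨h1, h2, -⟩ := Finset.mem_filter.1 hm₀
    have h3 := mem_annulus_iff h1
    have h4 := mem_annulus_iff h2
    rw [latticeVec_sub] at h4
    have := norm_sub_le (latticeVec k) (latticeVec m₀)
    linarith
  have := card_resonant_le F k hσ₁ hσ₂ (τ := τ) (a := M) (w := 2 * M) (P := 3 * M) (R := 3 * N)
    (by linarith) (by linarith) (by linarith) (by linarith) hk ?_
  · nlinarith
  · intro m hm
    obtain ⟨h1, h2, h3⟩ := Finset.mem_filter.1 hm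
    have h4 := mem_annulus_iff h1
    have h5 := mem_annulus_iff h2
    have h6 := norm_latticeVec_le_jbZ m
    have h7 := jbZ_le_norm_latticeVec_add_one m
    have h8 := jbZ_le_norm_latticeVec_add_one (k - m)
    refine ⟨⟨?_, ?_⟩, ?_, ?_, h3⟩ <;> linarith

/-- Resonance count for two frequencies at scale `N` in a common set of diameter `d`. -/
theorem card_resonant_diam_le {N d : ℝ} (hN : 1 ≤ N) (hd : 0 ≤ d) (hdN : d ≤ 3 / 2 * N)
    (S : Finset (Fin 3 → ℤ)) (hS : S ⊆ annulus N)
    (hdiam : ∀ m ∈ S, ∀ n ∈ S, ‖latticeVec m - latticeVec n‖ ≤ d) {σ : ℝ}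
    (hσ : σ = 1 ∨ σ = -1) (k : Fin 3 → ℤ) (τ : ℝ) :
    ((S.filter fun m => k - m ∈ S ∧ |σ * jbZ m + σ * jbZ (k - m) - τ| ≤ 1).card : ℝ) ≤
      38400 * N * (d + 1) := by
  set F := S.filter fun m => k - m ∈ S ∧ |σ * jbZ m + σ * jbZ (k - m) - τ| ≤ 1 with hF
  rcases F.eq_empty_or_nonempty with h0 | ⟨m₀, hm₀⟩
  · rw [h0]
    simp only [Finset.card_empty, Nat.cast_zero]
    positivity
  obtain ⟨hm₀S, hkm₀, -⟩ := Finset.mem_filter.1 hm₀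
  have hk : 3 * N ≤ 6 * ‖latticeVec k‖ := by
    have h3 := mem_annulus_iff (hS hm₀S)
    have h4 := hdiam _ hm₀S _ hkm₀
    have h5 : latticeVec k = (2 : ℝ) • latticeVec m₀ -
        (latticeVec m₀ - latticeVec (k - m₀)) := by
      rw [latticeVec_sub, two_smul]
      abel
    have h6 := norm_sub_norm_le ((2 : ℝ) • latticeVec m₀) (latticeVec m₀ - latticeVec (k - m₀))
    rw [← h5, norm_smul, Real.norm_two] at h6
    linarith
  have := card_resonant_le F k hσ hσ (τ := τ) (a := jbZ m₀ - d) (w := 2 * d) (P := 3 * N)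
    (R := 3 * N) (by linarith) (by linarith) (by linarith) le_rfl hk ?_
  · nlinarith
  · intro m hm
    obtain ⟨h1, h2, h3⟩ := Finset.mem_filter.1 hm
    have h4 := mem_annulus_iff (hS h1)
    have h5 := mem_annulus_iff (hS h2)
    have h6 := abs_le.1 ((abs_jbZ_sub_jbZ_le m m₀).trans (hdiam m h1 m₀ hm₀S))
    have h7 := jbZ_le_norm_latticeVec_add_one m
    have h8 := jbZ_le_norm_latticeVec_add_one (k - m)
    refine ⟨⟨?_, ?_⟩, ?_, ?_, h3⟩ <;> linarith

/-- The plane wave `x ↦ e^{i n·x}`. -/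
noncomputable def planeWave (n : Fin 3 → ℤ) (x : Fin 3 → ℝ) : ℂ :=
  Complex.exp (Complex.I * ((dotZ n x : ℝ) : ℂ))

theorem continuous_planeWave (n : Fin 3 → ℤ) : Continuous (planeWave n) := by
  unfold planeWave dotZ
  fun_prop

theorem norm_planeWave (n : Fin 3 → ℤ) (x : Fin 3 → ℝ) : ‖planeWave n x‖ = 1 := by
  rw [planeWave, mul_comm, Complex.norm_exp_ofReal_mul_I]

theorem planeWave_add (m n : Fin 3 → ℤ) (x : Fin 3 → ℝ) :
    planeWave (m + n) x = planeWave m x * planeWave n x := by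
  rw [planeWave, planeWave, planeWave, ← Complex.exp_add, ← mul_add, ← Complex.ofReal_add]
  congr 3
  simp only [dotZ, Pi.add_apply, Int.cast_add, add_mul, Finset.sum_add_distrib]

theorem conj_planeWave (n : Fin 3 → ℤ) (x : Fin 3 → ℝ) :
    (starRingEnd ℂ) (planeWave n x) = planeWave (-n) x := by
  rw [planeWave, planeWave, ← Complex.exp_conj, map_mul, Complex.conj_I, Complex.conj_ofReal]
  congr 1
  simp only [dotZ, Pi.neg_apply, Int.cast_neg, neg_mul, Finset.sum_neg_distrib, Complex.ofReal_neg]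
  ring

theorem volume_restrict_cube : (volume : Measure (Fin 3 → ℝ)).restrict cube =
    Measure.pi fun _ => (volume : Measure ℝ).restrict (Set.Ico 0 (2 * Real.pi)) := by
  rw [cube, volume_pi, Measure.restrict_pi_pi]

instance isFiniteMeasure_restrict_cube :
    IsFiniteMeasure ((volume : Measure (Fin 3 → ℝ)).restrict cube) := by
  rw [volume_restrict_cube]
  infer_instance

theorem integral_exp_int_mul (n : ℤ) :
    ∫ x in Set.Ico 0 (2 * Real.pi), Complex.exp (Complex.I * ((n * x : ℝ) : ℂ)) =
      if n = 0 then ((2 * Real.pi : ℝ) : ℂ) else 0 := by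
  rw [integral_Ico_eq_integral_Ioc, ← intervalIntegral.integral_of_le (by positivity)]
  split_ifs with h
  · simp [h]
  · have h1 : Complex.I * (n : ℂ) ≠ 0 := mul_ne_zero Complex.I_ne_zero (by exact_mod_cast h)
    have h2 := integral_exp_mul_complex (a := 0) (b := 2 * Real.pi) h1
    have h3 : Complex.exp (Complex.I * (n : ℂ) * ((2 * Real.pi : ℝ) : ℂ)) = 1 := by
      rw [← Complex.exp_int_mul_two_pi_mul_I n]
      push_cast
      ring_nf
    rw [h3] at h2
    simp only [Complex.ofReal_zero, mul_zero, Complex.exp_zero, sub_self, zero_div] at h2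
    rw [← h2]
    congr 1
    ext x
    push_cast
    ring_nf

theorem integral_planeWave (n : Fin 3 → ℤ) :
    ∫ x in cube, planeWave n x = if n = 0 then (((2 * Real.pi) ^ 3 : ℝ) : ℂ) else 0 := by
  have h1 : ∀ x, planeWave n x = ∏ i, Complex.exp (Complex.I * ((n i * x i : ℝ) : ℂ)) := by
    intro x
    rw [planeWave, dotZ, ← Complex.exp_sum, ← Finset.mul_sum, Complex.ofReal_sum]
  simp only [h1]
  rw [volume_restrict_cube,
    integral_fintype_prod_eq_prod fun i (y : ℝ) => Complex.exp (Complex.I * ((n i * y : ℝ) : ℂ))]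
  simp only [integral_exp_int_mul]
  split_ifs with h
  · simp [h]
  · obtain ⟨i, hi⟩ := Function.ne_iff.1 h
    exact Finset.prod_eq_zero (Finset.mem_univ i) (if_neg hi)

/-- Parseval's identity for trigonometric polynomials on `T³`. -/
theorem lintegral_sum_planeWave_sq (Z : Finset (Fin 3 → ℤ)) (c : (Fin 3 → ℤ) → ℂ) :
    ∫⁻ x in cube, ‖∑ k ∈ Z, c k * planeWave k x‖ₑ ^ 2 =
      ENNReal.ofReal ((2 * Real.pi) ^ 3) * ∑ k ∈ Z, ‖c k‖ₑ ^ 2 := by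
  have hint : ∀ n, Integrable (planeWave n) (volume.restrict cube) := fun n =>
    (integrable_const (1 : ℝ)).mono' (continuous_planeWave n).aestronglyMeasurable
      (Eventually.of_forall fun x => (norm_planeWave n x).le)
  have hpt : ∀ x, ((‖∑ k ∈ Z, c k * planeWave k x‖ ^ 2 : ℝ) : ℂ) =
      ∑ k ∈ Z, ∑ l ∈ Z, c k * (starRingEnd ℂ) (c l) * planeWave (k - l) x := by
    intro x
    rw [Complex.ofReal_pow, ← Complex.mul_conj', map_sum, Finset.sum_mul_sum]
    refine Finset.sum_congr rfl fun k _ => Finset.sum_congr rfl fun l _ => ?_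
    rw [map_mul, conj_planeWave, sub_eq_add_neg, planeWave_add]
    ring
  have hI : Integrable (fun x => ((‖∑ k ∈ Z, c k * planeWave k x‖ ^ 2 : ℝ) : ℂ))
      (volume.restrict cube) := by
    simp only [hpt]
    exact integrable_finsetSum _ fun k _ => integrable_finsetSum _ fun l _ =>
      (hint _).const_mul _
  have hreal : ∫ x in cube, ‖∑ k ∈ Z, c k * planeWave k x‖ ^ 2 =
      (2 * Real.pi) ^ 3 * ∑ k ∈ Z, ‖c k‖ ^ 2 := by
    rw [← Complex.ofReal_inj, ← integral_complex_ofReal]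
    simp only [hpt]
    rw [integral_finsetSum _ fun k _ => integrable_finsetSum _ fun l _ => (hint _).const_mul _,
      Complex.ofReal_mul, Complex.ofReal_sum, Finset.mul_sum]
    refine Finset.sum_congr rfl fun k hk => ?_
    rw [integral_finsetSum _ fun l _ => (hint _).const_mul _]
    simp only [integral_const_mul, integral_planeWave, sub_eq_zero]
    rw [Finset.sum_eq_single k (fun l _ hl => by rw [if_neg hl.symm, mul_zero])
      (fun h => absurd hk h), if_pos rfl, Complex.mul_conj']
    push_cast
    ring
  have hen : ∀ z : ℂ, ‖z‖ₑ ^ 2 = ENNReal.ofReal (‖z‖ ^ 2) := fun z => by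
    rw [ENNReal.ofReal_pow (norm_nonneg _), ofReal_norm]
  simp only [hen]
  rw [← ofReal_integral_eq_lintegral_ofReal (by simpa using hI.norm)
    (Eventually.of_forall fun x => by positivity),
    hreal, ENNReal.ofReal_mul (by positivity),
    ENNReal.ofReal_sum_of_nonneg fun k _ => by positivity]

/-- The convolution of the coefficients of two trigonometric polynomials. -/
noncomputable def coeffConv (S S' : Finset (Fin 3 → ℤ)) (a b : (Fin 3 → ℤ) → ℂ)
    (k : Fin 3 → ℤ) : ℂ :=
  ∑ m ∈ S, ∑ n ∈ S', if m + n = k then a m * b n else 0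

theorem coeffConv_congr {S S' : Finset (Fin 3 → ℤ)} {a a' b b' : (Fin 3 → ℤ) → ℂ}
    (ha : ∀ m ∈ S, a m = a' m) (hb : ∀ n ∈ S', b n = b' n) (k : Fin 3 → ℤ) :
    coeffConv S S' a b k = coeffConv S S' a' b' k :=
  Finset.sum_congr rfl fun m hm => Finset.sum_congr rfl fun n hn => by rw [ha m hm, hb n hn]

theorem coeffConv_eq_zero {S S' : Finset (Fin 3 → ℤ)} {k : Fin 3 → ℤ}
    (hk : ∀ m ∈ S, ∀ n ∈ S', m + n ≠ k) (a b : (Fin 3 → ℤ) → ℂ) : coeffConv S S' a b k = 0 :=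
  Finset.sum_eq_zero fun m hm => Finset.sum_eq_zero fun n hn => if_neg (hk m hm n hn)

theorem coeffConv_eq_sum_filter (S S' : Finset (Fin 3 → ℤ)) (a b : (Fin 3 → ℤ) → ℂ)
    (k : Fin 3 → ℤ) :
    coeffConv S S' a b k = ∑ m ∈ S.filter fun m => k - m ∈ S', a m * b (k - m) := by
  rw [coeffConv, Finset.sum_filter]
  refine Finset.sum_congr rfl fun m _ => ?_
  have h : ∀ n, m + n = k ↔ n = k - m := fun n => by rw [eq_sub_iff_add_eq, add_comm]
  simp only [h, Finset.sum_ite_eq']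

theorem sum_mul_sum_planeWave (S S' Z : Finset (Fin 3 → ℤ)) (a b : (Fin 3 → ℤ) → ℂ)
    (hZ : ∀ m ∈ S, ∀ n ∈ S', m + n ∈ Z) (x : Fin 3 → ℝ) :
    (∑ m ∈ S, a m * planeWave m x) * ∑ n ∈ S', b n * planeWave n x =
      ∑ k ∈ Z, coeffConv S S' a b k * planeWave k x := by
  simp only [coeffConv, Finset.sum_mul, ite_mul, zero_mul]
  rw [Finset.sum_comm]
  refine Finset.sum_congr rfl fun m hm => ?_
  rw [Finset.sum_comm, Finset.mul_sum]
  refine Finset.sum_congr rfl fun n hn => ?_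
  rw [Finset.sum_ite_eq, if_pos (hZ m hm n hn), planeWave_add]
  ring

theorem memLp_planeWave (n : Fin 3 → ℤ) (p : ℝ≥0∞) :
    MemLp (planeWave n) p (volume.restrict cube) :=
  MemLp.of_bound (continuous_planeWave n).aestronglyMeasurable 1
    (Eventually.of_forall fun x => (norm_planeWave n x).le)

/-- The function `∑_{n ∈ S} a_n e^{i n·x}` as an element of `L⁴(T³)`. -/
noncomputable def trigPoly (S : Finset (Fin 3 → ℤ)) (a : (Fin 3 → ℤ) → ℂ) :
    Lp ℂ 4 (volume.restrict cube) :=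
  ∑ n ∈ S, a n • (memLp_planeWave n 4).toLp

theorem coeFn_trigPoly (S : Finset (Fin 3 → ℤ)) (a : (Fin 3 → ℤ) → ℂ) :
    trigPoly S a =ᵐ[volume.restrict cube] fun x => ∑ n ∈ S, a n * planeWave n x := by
  unfold trigPoly
  induction S using Finset.induction_on with
  | empty =>
    simp only [Finset.sum_empty]
    exact Lp.coeFn_zero _ _ _
  | insert n S hn ih =>
    rw [Finset.sum_insert hn]
    filter_upwards [ih, Lp.coeFn_add (a n • (memLp_planeWave n 4).toLp)
      (∑ n ∈ S, a n • (memLp_planeWave n 4).toLp), Lp.coeFn_smul (a n) (memLp_planeWave n 4).toLp,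
      (memLp_planeWave n 4).coeFn_toLp] with x h1 h2 h3 h4
    rw [h2, Pi.add_apply, h1, h3, Pi.smul_apply, h4, Finset.sum_insert hn, smul_eq_mul]

theorem enorm_trigPoly_pow_four (S : Finset (Fin 3 → ℤ)) (a : (Fin 3 → ℤ) → ℂ) :
    ‖trigPoly S a‖ₑ ^ 4 = ∫⁻ x in cube, ‖∑ n ∈ S, a n * planeWave n x‖ₑ ^ 4 := by
  rw [Lp.enorm_def, eLpNorm_congr_ae (coeFn_trigPoly S a),
    eLpNorm_eq_lintegral_rpow_enorm_toReal (by norm_num) (by norm_num), ENNReal.toReal_ofNat,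
    ← ENNReal.rpow_natCast, ← ENNReal.rpow_mul]
  norm_num

/-- The `L⁴(T³)` norm of a trigonometric polynomial through its self-convolution. -/
theorem enorm_trigPoly_pow_four_eq (S Z : Finset (Fin 3 → ℤ)) (a : (Fin 3 → ℤ) → ℂ)
    (hZ : ∀ m ∈ S, ∀ n ∈ S, m + n ∈ Z) :
    ‖trigPoly S a‖ₑ ^ 4 =
      ENNReal.ofReal ((2 * Real.pi) ^ 3) * ∑ k ∈ Z, ‖coeffConv S S a a k‖ₑ ^ 2 := by
  rw [enorm_trigPoly_pow_four, ← lintegral_sum_planeWave_sq]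
  refine lintegral_congr fun x => ?_
  rw [← sum_mul_sum_planeWave S S Z a a hZ, enorm_mul]
  ring

/-- Hölder's inequality for the product of two trigonometric polynomials. -/
theorem sum_coeffConv_sq_le (S S' Z : Finset (Fin 3 → ℤ)) (a b : (Fin 3 → ℤ) → ℂ) :
    ENNReal.ofReal ((2 * Real.pi) ^ 3) * ∑ k ∈ Z, ‖coeffConv S S' a b k‖ₑ ^ 2 ≤
      ‖trigPoly S a‖ₑ ^ 2 * ‖trigPoly S' b‖ₑ ^ 2 := by
  set Z' := Z ∪ (S ×ˢ S').image fun p => p.1 + p.2 with hZ'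
  have hsub : ∀ m ∈ S, ∀ n ∈ S', m + n ∈ Z' := fun m hm n hn =>
    Finset.mem_union_right _ (Finset.mem_image.2 ⟨(m, n), Finset.mem_product.2 ⟨hm, hn⟩, rfl⟩)
  have hmeas : ∀ (S : Finset (Fin 3 → ℤ)) (a : (Fin 3 → ℤ) → ℂ), AEMeasurable
      (fun x => ‖∑ n ∈ S, a n * planeWave n x‖ₑ ^ 2) (volume.restrict cube) := fun S a =>
    Continuous.aemeasurable <| by
      have := continuous_planeWave
      fun_prop
  have hroot : ∀ (S : Finset (Fin 3 → ℤ)) (a : (Fin 3 → ℤ) → ℂ),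
      (∫⁻ x in cube, (‖∑ n ∈ S, a n * planeWave n x‖ₑ ^ 2) ^ (2 : ℝ)) ^ (1 / (2 : ℝ)) =
        ‖trigPoly S a‖ₑ ^ 2 := by
    intro S a
    have : ∀ y : ℝ≥0∞, (y ^ 2) ^ (2 : ℝ) = y ^ 4 := fun y => by
      rw [ENNReal.rpow_ofNat, ← pow_mul]
    simp only [this]
    rw [← enorm_trigPoly_pow_four, ← ENNReal.rpow_natCast, ← ENNReal.rpow_mul,
      ← ENNReal.rpow_natCast]
    norm_num
  calc ENNReal.ofReal ((2 * Real.pi) ^ 3) * ∑ k ∈ Z, ‖coeffConv S S' a b k‖ₑ ^ 2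
      ≤ ENNReal.ofReal ((2 * Real.pi) ^ 3) * ∑ k ∈ Z', ‖coeffConv S S' a b k‖ₑ ^ 2 := by
        gcongr
        exact Finset.subset_union_left
    _ = ∫⁻ x in cube, ‖∑ n ∈ S, a n * planeWave n x‖ₑ ^ 2 *
          ‖∑ n ∈ S', b n * planeWave n x‖ₑ ^ 2 := by
        rw [← lintegral_sum_planeWave_sq]
        refine lintegral_congr fun x => ?_
        rw [← sum_mul_sum_planeWave S S' Z' a b hsub, enorm_mul, mul_pow]
    _ ≤ _ := by
        refine (ENNReal.lintegral_mul_le_Lp_mul_Lq _ Real.HolderConjugate.two_two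
          (hmeas S a) (hmeas S' b)).trans_eq ?_
        rw [hroot, hroot]

/-- Bilinear `L²` estimate for free half-waves in terms of the number of resonant pairs of
frequencies. -/
theorem exists_lintegral_coeffConv_free_le (T : ℝ) : ∃ C > (0 : ℝ),
    ∀ (S S' Z : Finset (Fin 3 → ℤ)) (σ₁ σ₂ : ℝ) (K : ℝ),
      (∀ k τ, ((S.filter fun m => k - m ∈ S' ∧
        |σ₁ * jbZ m + σ₂ * jbZ (k - m) - τ| ≤ 1).card : ℝ) ≤ K) →
      ∀ a b : (Fin 3 → ℤ) → ℂ,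
        ∫⁻ t in Set.Icc 0 T, ∑ k ∈ Z, ‖coeffConv S S'
            (fun m => Complex.exp (Complex.I * (σ₁ * jbZ m * t : ℝ)) * a m)
            (fun n => Complex.exp (Complex.I * (σ₂ * jbZ n * t : ℝ)) * b n) k‖ₑ ^ 2 ≤
          ENNReal.ofReal (C * K * (∑ m ∈ S, ‖a m‖ ^ 2) * ∑ n ∈ S', ‖b n‖ ^ 2) := by
  obtain ⟨C, hC, h⟩ := exists_lintegral_expSum_le T
  refine ⟨C, hC, fun S S' Z σ₁ σ₂ K hK a b => ?_⟩
  have hK0 : 0 ≤ K := (Nat.cast_nonneg _).trans (hK 0 0)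
  set J : (Fin 3 → ℤ) → Finset (Fin 3 → ℤ) := fun k => S.filter fun m => k - m ∈ S' with hJ
  have hfree : ∀ k t, coeffConv S S'
      (fun m => Complex.exp (Complex.I * (σ₁ * jbZ m * t : ℝ)) * a m)
      (fun n => Complex.exp (Complex.I * (σ₂ * jbZ n * t : ℝ)) * b n) k =
      ∑ m ∈ J k, (a m * b (k - m)) *
        Complex.exp (Complex.I * ((σ₁ * jbZ m + σ₂ * jbZ (k - m)) * t : ℝ)) := by
    intro k t
    rw [coeffConv_eq_sum_filter]
    refine Finset.sum_congr rfl fun m _ => ?_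
    rw [add_mul, Complex.ofReal_add, mul_add, Complex.exp_add]
    ring
  simp only [hfree]
  rw [lintegral_finsetSum _ fun k _ => by fun_prop]
  have hle : ∀ k ∈ Z, ∫⁻ t in Set.Icc 0 T, ‖∑ m ∈ J k, (a m * b (k - m)) *
        Complex.exp (Complex.I * ((σ₁ * jbZ m + σ₂ * jbZ (k - m)) * t : ℝ))‖ₑ ^ 2 ≤
      ENNReal.ofReal (C * K * ∑ m ∈ J k, ‖a m‖ ^ 2 * ‖b (k - m)‖ ^ 2) := by
    intro k _
    refine (h (J k) (fun m => a m * b (k - m)) (fun m => σ₁ * jbZ m + σ₂ * jbZ (k - m)) ⌊K⌋₊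
      fun τ => Nat.le_floor ?_).trans ?_
    · rw [hJ, Finset.filter_filter]
      exact hK k τ
    · simp only [norm_mul, mul_pow]
      refine ENNReal.ofReal_le_ofReal ?_
      gcongr
      exact Nat.floor_le hK0
  refine (Finset.sum_le_sum hle).trans ?_
  rw [← ENNReal.ofReal_sum_of_nonneg fun k _ => by positivity]
  refine ENNReal.ofReal_le_ofReal ?_
  rw [← Finset.mul_sum, mul_assoc (C * K)]
  gcongr
  simp only [hJ, Finset.sum_filter]
  rw [Finset.sum_comm, Finset.sum_mul]
  refine Finset.sum_le_sum fun m _ => ?_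
  rw [← Finset.sum_filter, ← Finset.mul_sum]
  gcongr
  rw [← Finset.sum_image (f := fun n => ‖b n‖ ^ 2) (g := fun k => k - m)
    fun x _ y _ hxy => sub_left_injective hxy]
  refine Finset.sum_le_sum_of_subset_of_nonneg ?_ fun _ _ _ => by positivity
  intro n hn
  obtain ⟨k, hk, rfl⟩ := Finset.mem_image.1 hn
  exact (Finset.mem_filter.1 hk).2

/-- The coefficients `(e^{iσt⟨m⟩} φ_m)_{m ∈ S}` of the free half-wave with data `φ`, extended by
zero. -/
noncomputable def freeWave (S : Finset (Fin 3 → ℤ)) (σ t : ℝ) :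
    EuclideanSpace ℂ ↥S →ₗ[ℂ] (Fin 3 → ℤ) → ℂ where
  toFun φ m := Complex.exp (Complex.I * (σ * jbZ m * t : ℝ)) * if h : m ∈ S then φ ⟨m, h⟩ else 0
  map_add' φ ψ := by
    ext m
    by_cases h : m ∈ S <;> simp [h, mul_add]
  map_smul' z φ := by
    ext m
    by_cases h : m ∈ S <;> simp [h, mul_left_comm]

theorem freeWave_modCurve (S : Finset (Fin 3 → ℤ)) (σ t : ℝ) (c : (Fin 3 → ℤ) → ℝ → ℂ)
    {m : Fin 3 → ℤ} (hm : m ∈ S) : freeWave S σ t (modCurve S σ c t) m = c m t := by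
  simp only [freeWave, LinearMap.coe_mk, AddHom.coe_mk, hm, dif_pos]
  change _ * (Complex.exp (-(Complex.I * ((σ * jbZ m * t : ℝ) : ℂ))) * c m t) = _
  rw [← mul_assoc, ← Complex.exp_add, add_neg_cancel, Complex.exp_zero, one_mul]

theorem continuous_freeWave (S : Finset (Fin 3 → ℤ)) (σ : ℝ) (φ : EuclideanSpace ℂ ↥S)
    (m : Fin 3 → ℤ) : Continuous fun t => freeWave S σ t φ m := by
  simp only [freeWave, LinearMap.coe_mk, AddHom.coe_mk]
  fun_prop

theorem sum_norm_sq_extend (S : Finset (Fin 3 → ℤ)) (φ : EuclideanSpace ℂ ↥S) :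
    ∑ m ∈ S, ‖if h : m ∈ S then φ ⟨m, h⟩ else 0‖ ^ 2 = ‖φ‖ ^ 2 := by
  rw [EuclideanSpace.norm_sq_eq, ← Finset.sum_coe_sort S]
  exact Finset.sum_congr rfl fun m _ => by simp

theorem measurable_coeffConv (S S' : Finset (Fin 3 → ℤ)) {a b : (Fin 3 → ℤ) → ℝ → ℂ}
    (ha : ∀ m, Measurable (a m)) (hb : ∀ n, Measurable (b n)) (k : Fin 3 → ℤ) :
    Measurable fun t => coeffConv S S' (fun m => a m t) (fun n => b n t) k := by
  unfold coeffConv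
  refine Finset.measurable_fun_sum _ fun m _ => Finset.measurable_fun_sum _ fun n _ => ?_
  split_ifs
  · exact (ha m).mul (hb n)
  · exact measurable_const

theorem eLpNorm_projProd_sq (T O M N : ℝ) {c c' : (Fin 3 → ℤ) → ℝ → ℂ}
    (hc : ∀ m, Measurable (c m)) (hc' : ∀ n, Measurable (c' n)) :
    eLpNorm (fun p : ℝ × (Fin 3 → ℝ) => projProd O M N c c' p.1 p.2) 2
        (volume.restrict (Set.Icc 0 T ×ˢ cube)) ^ 2 =
      ENNReal.ofReal ((2 * Real.pi) ^ 3) * ∫⁻ t in Set.Icc 0 T, ∑ k ∈ annulus O,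
        ‖coeffConv (annulus M) (annulus N) (fun m => c m t) (fun n => c' n t) k‖ₑ ^ 2 := by
  have hproj : ∀ t x, projProd O M N c c' t x = ∑ k ∈ annulus O,
      coeffConv (annulus M) (annulus N) (fun m => c m t) (fun n => c' n t) k * planeWave k x :=
    fun t x => rfl
  have hmeas := measurable_coeffConv (annulus M) (annulus N) hc hc'
  rw [eLpNorm_eq_lintegral_rpow_enorm_toReal (by norm_num) (by norm_num), ENNReal.toReal_ofNat,
    ← ENNReal.rpow_natCast, ← ENNReal.rpow_mul]
  norm_num
  rw [Measure.volume_eq_prod, ← Measure.prod_restrict, lintegral_prod, ← lintegral_const_mul]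
  · simp only [hproj, lintegral_sum_planeWave_sq]
  · fun_prop
  · refine Measurable.aemeasurable ?_
    simp only [hproj]
    exact (Finset.measurable_fun_sum _ fun k _ => ((hmeas k).comp measurable_fst).mul
      ((continuous_planeWave k).measurable.comp measurable_snd)).enorm.pow_const 2

/-- The convolution of coefficients, restricted to a set of output frequencies, as a bilinear
map. -/
noncomputable def coeffConvBilin (S S' Z : Finset (Fin 3 → ℤ)) :
    ((Fin 3 → ℤ) → ℂ) →ₗ[ℂ] ((Fin 3 → ℤ) → ℂ) →ₗ[ℂ] EuclideanSpace ℂ ↥Z :=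
  LinearMap.mk₂ ℂ (fun a b => WithLp.toLp 2 fun k : ↥Z => coeffConv S S' a b k)
    (fun a a' b => by
      ext k
      simp only [coeffConv_eq_sum_filter, Pi.add_apply, add_mul, Finset.sum_add_distrib,
        PiLp.add_apply])
    (fun z a b => by
      ext k
      simp only [coeffConv_eq_sum_filter, Pi.smul_apply, smul_eq_mul, mul_assoc, Finset.mul_sum,
        PiLp.smul_apply])
    (fun a b b' => by
      ext k
      simp only [coeffConv_eq_sum_filter, Pi.add_apply, mul_add, Finset.sum_add_distrib,
        PiLp.add_apply])
    (fun z a b => by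
      ext k
      simp only [coeffConv_eq_sum_filter, Pi.smul_apply, smul_eq_mul, mul_left_comm,
        Finset.mul_sum, PiLp.smul_apply])

theorem enorm_toLp_sq {ι : Type*} [Fintype ι] {E : ι → Type*}
    [∀ i, NormedAddCommGroup (E i)] (f : ∀ i, E i) :
    ‖WithLp.toLp 2 f‖ₑ ^ 2 = ∑ i, ‖f i‖ₑ ^ 2 := by
  have h := PiLp.norm_sq_eq_of_L2 _ (WithLp.toLp 2 f)
  rw [← ofReal_norm, ← ENNReal.ofReal_pow (norm_nonneg _), h,
    ENNReal.ofReal_sum_of_nonneg fun _ _ => by positivity]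
  exact Finset.sum_congr rfl fun i _ => by rw [ENNReal.ofReal_pow (norm_nonneg _), ofReal_norm]

theorem enorm_coeffConvBilin_sq (S S' Z : Finset (Fin 3 → ℤ)) (a b : (Fin 3 → ℤ) → ℂ) :
    ‖coeffConvBilin S S' Z a b‖ₑ ^ 2 = ∑ k ∈ Z, ‖coeffConv S S' a b k‖ₑ ^ 2 := by
  rw [coeffConvBilin, LinearMap.mk₂_apply, enorm_toLp_sq]
  exact Finset.sum_coe_sort Z fun k => ‖coeffConv S S' a b k‖ₑ ^ 2

/-- Transference of a bilinear `L²` estimate for free half-waves to the adapted spaces `U²`. -/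
theorem lintegral_coeffConv_le_UpNorm (T : ℝ) (S S' Z : Finset (Fin 3 → ℤ)) (σ₁ σ₂ : ℝ)
    {A : ℝ≥0∞} (hA : A ≠ ⊤)
    (hfree : ∀ φ ψ, ∫⁻ t in Set.Icc 0 T, ∑ k ∈ Z,
      ‖coeffConv S S' (freeWave S σ₁ t φ) (freeWave S' σ₂ t ψ) k‖ₑ ^ 2 ≤
        (A * ‖φ‖ₑ * ‖ψ‖ₑ) ^ 2)
    {c c' : (Fin 3 → ℤ) → ℝ → ℂ} (hc' : ∀ n, Measurable (c' n))
    (hU : UpNorm 2 (modCurve S σ₁ c) ≠ ⊤) (hV : UpNorm 2 (modCurve S' σ₂ c') ≠ ⊤) :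
    ∫⁻ t in Set.Icc 0 T, ∑ k ∈ Z, ‖coeffConv S S' (fun m => c m t) (fun n => c' n t) k‖ₑ ^ 2 ≤
      (A * UpNorm 2 (modCurve S σ₁ c) * UpNorm 2 (modCurve S' σ₂ c')) ^ 2 := by
  have hmeas : ∀ {f : ℝ → EuclideanSpace ℂ ↥Z}, (∀ k, Measurable fun t => f t k) →
      Measurable fun t => ‖f t‖ₑ := fun {f} hf => by
    have : Measurable f := (WithLp.measurable_toLp 2 _).comp (measurable_pi_lambda _ hf)
    exact this.enorm
  have hfree_meas : ∀ (S : Finset (Fin 3 → ℤ)) σ φ m, Measurable fun t => freeWave S σ t φ m :=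
    fun S σ φ m => (continuous_freeWave S σ φ m).measurable
  have h1 : ∀ φ, ∫⁻ t in Set.Icc 0 T,
      ‖coeffConvBilin S S' Z (freeWave S σ₁ t φ) (fun n => c' n t)‖ₑ ^ (2 : ℝ) ≤
        ((A * UpNorm 2 (modCurve S' σ₂ c')) * ‖φ‖ₑ) ^ (2 : ℝ) := by
    intro φ
    have h := lintegral_map_le_UpNorm (p := 2) one_le_two (volume.restrict (Set.Icc 0 T))
      (fun t => (coeffConvBilin S S' Z (freeWave S σ₁ t φ)).comp (freeWave S' σ₂ t))
      (fun ψ => hmeas fun k => measurable_coeffConv S S' (hfree_meas S σ₁ φ)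
        (hfree_meas S' σ₂ ψ) k)
      (A := A * ‖φ‖ₑ) (ENNReal.mul_ne_top hA enorm_ne_top) (fun ψ => ?_) hV
    · rw [mul_right_comm]
      refine le_trans (le_of_eq ?_) h
      refine lintegral_congr fun t => ?_
      simp only [ENNReal.rpow_ofNat, LinearMap.comp_apply, enorm_coeffConvBilin_sq]
      exact Finset.sum_congr rfl fun k _ => by
        rw [coeffConv_congr (fun _ _ => rfl) fun n hn => (freeWave_modCurve S' σ₂ t c' hn).symm]
    · simp only [ENNReal.rpow_ofNat, LinearMap.comp_apply, enorm_coeffConvBilin_sq]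
      exact hfree φ ψ
  have h := lintegral_map_le_UpNorm (p := 2) one_le_two (volume.restrict (Set.Icc 0 T))
    (fun t => ((coeffConvBilin S S' Z).flip fun n => c' n t).comp (freeWave S σ₁ t))
    (fun φ => hmeas fun k => measurable_coeffConv S S' (hfree_meas S σ₁ φ) hc' k)
    (ENNReal.mul_ne_top hA hV) h1 hU
  rw [mul_right_comm]
  simp only [ENNReal.rpow_ofNat, LinearMap.comp_apply, LinearMap.flip_apply,
    enorm_coeffConvBilin_sq] at h
  refine le_trans (le_of_eq ?_) h
  refine lintegral_congr fun t => Finset.sum_congr rfl fun k _ => ?_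
  rw [coeffConv_congr (fun m hm => (freeWave_modCurve S σ₁ t c hm).symm) fun _ _ => rfl]

theorem eLpNorm_projProd_eq_zero (μ : Measure (ℝ × (Fin 3 → ℝ))) {O M N : ℝ}
    {c c' : (Fin 3 → ℤ) → ℝ → ℂ}
    (h : ∀ t, ∀ k ∈ annulus O,
      coeffConv (annulus M) (annulus N) (fun m => c m t) (fun n => c' n t) k = 0) :
    eLpNorm (fun p : ℝ × (Fin 3 → ℝ) => projProd O M N c c' p.1 p.2) 2 μ = 0 := by
  have : (fun p : ℝ × (Fin 3 → ℝ) => projProd O M N c c' p.1 p.2) = 0 := by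
    ext p
    exact Finset.sum_eq_zero fun k hk => mul_eq_zero_of_left (h p.1 k hk) _
  rw [this, eLpNorm_zero]

theorem eq_zero_of_UpNorm_modCurve_eq_zero {p : ℝ} (hp : 1 ≤ p) {S : Finset (Fin 3 → ℤ)} {σ : ℝ}
    {c : (Fin 3 → ℤ) → ℝ → ℂ} (h : UpNorm p (modCurve S σ c) = 0) (t : ℝ) {m : Fin 3 → ℤ}
    (hm : m ∈ S) : c m t = 0 := by
  rw [← freeWave_modCurve S σ t c hm, eq_zero_of_UpNorm_eq_zero hp h t, map_zero, Pi.zero_apply]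

/-- Reduction of an estimate in adapted spaces to functions with finite norms. -/
theorem eLpNorm_projProd_le_of_ne_top {p : ℝ} (hp : 1 ≤ p) (T : ℝ) {O M N σ₁ σ₂ D : ℝ} (hD : 0 < D)
    {c c' : (Fin 3 → ℤ) → ℝ → ℂ} (hc : ∀ m, Measurable (c m)) (hc' : ∀ n, Measurable (c' n))
    (h : UpNorm p (modCurve (annulus M) σ₁ c) ≠ ⊤ → UpNorm p (modCurve (annulus N) σ₂ c') ≠ ⊤ →
      ENNReal.ofReal ((2 * Real.pi) ^ 3) * ∫⁻ t in Set.Icc 0 T, ∑ k ∈ annulus O,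
        ‖coeffConv (annulus M) (annulus N) (fun m => c m t) (fun n => c' n t) k‖ₑ ^ 2 ≤
      (ENNReal.ofReal D * UpNorm p (modCurve (annulus M) σ₁ c) *
        UpNorm p (modCurve (annulus N) σ₂ c')) ^ 2) :
    eLpNorm (fun p : ℝ × (Fin 3 → ℝ) => projProd O M N c c' p.1 p.2) 2
        (volume.restrict (Set.Icc 0 T ×ˢ cube)) ≤
      ENNReal.ofReal D * UpNorm p (modCurve (annulus M) σ₁ c) *
        UpNorm p (modCurve (annulus N) σ₂ c') := by
  have hD' : ENNReal.ofReal D ≠ 0 := by simpa using hD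
  by_cases hU0 : UpNorm p (modCurve (annulus M) σ₁ c) = 0
  · rw [eLpNorm_projProd_eq_zero _ fun t k _ => Finset.sum_eq_zero fun m hm =>
      Finset.sum_eq_zero fun n _ => by
        beta_reduce
        rw [eq_zero_of_UpNorm_modCurve_eq_zero hp hU0 t hm, zero_mul, ite_self]]
    exact zero_le
  by_cases hV0 : UpNorm p (modCurve (annulus N) σ₂ c') = 0
  · rw [eLpNorm_projProd_eq_zero _ fun t k _ => Finset.sum_eq_zero fun m _ =>
      Finset.sum_eq_zero fun n hn => by
        beta_reduce
        rw [eq_zero_of_UpNorm_modCurve_eq_zero hp hV0 t hn, mul_zero, ite_self]]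
    exact zero_le
  by_cases hU : UpNorm p (modCurve (annulus M) σ₁ c) = ⊤
  · rw [hU, ENNReal.mul_top hD', ENNReal.top_mul hV0]
    exact le_top
  by_cases hV : UpNorm p (modCurve (annulus N) σ₂ c') = ⊤
  · rw [hV, ENNReal.mul_top (mul_ne_zero hD' hU0)]
    exact le_top
  rw [← ENNReal.pow_le_pow_left_iff two_ne_zero, eLpNorm_projProd_sq T O M N hc hc']
  exact h hU hV

/-- Bilinear estimate in `U²` for separated frequency scales. -/
theorem exists_eLpNorm_projProd_separated_le (T : ℝ) : ∃ C > (0 : ℝ), ∀ M N O : ℝ, 1 ≤ M → 1 ≤ N →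
    1 ≤ O → ∀ σ₁ σ₂ : ℝ, (σ₁ = 1 ∨ σ₁ = -1) → (σ₂ = 1 ∨ σ₂ = -1) →
    ∀ c c' : (Fin 3 → ℤ) → ℝ → ℂ, (∀ m, Measurable (c m)) → (∀ n, Measurable (c' n)) →
    4 * M ≤ N →
      eLpNorm (fun p : ℝ × (Fin 3 → ℝ) => projProd O M N c c' p.1 p.2)
          2 (volume.restrict (Set.Icc 0 T ×ˢ cube)) ≤
        ENNReal.ofReal (C * min O (min M N)) *
          UpNorm 2 (modCurve (annulus M) σ₁ c) * UpNorm 2 (modCurve (annulus N) σ₂ c') := by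
  obtain ⟨C, hC, hfree⟩ := exists_lintegral_coeffConv_free_le T
  refine ⟨√((2 * Real.pi) ^ 3) * √(C * 76800), by positivity,
    fun M N O hM hN hO σ₁ σ₂ hσ₁ hσ₂ c c' hc hc' hMN => ?_⟩
  rcases le_or_gt M O with hMO | hMO
  swap
  · rw [eLpNorm_projProd_eq_zero _ fun t k hk => coeffConv_eq_zero (fun m hm n hn hmn => ?_) _ _]
    · exact zero_le
    · have h1 := mem_annulus_iff hk
      have h2 := mem_annulus_iff hm
      have h3 := mem_annulus_iff hn
      have h4 := norm_sub_le (latticeVec k) (latticeVec m)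
      rw [← latticeVec_sub, ← hmn, add_sub_cancel_left, hmn] at h4
      linarith
  rw [min_eq_left (by linarith : M ≤ N), min_eq_right hMO]
  refine eLpNorm_projProd_le_of_ne_top one_le_two T (by positivity) hc hc' fun hU hV => ?_
  have h := lintegral_coeffConv_le_UpNorm T (annulus M) (annulus N) (annulus O) σ₁ σ₂
    (A := ENNReal.ofReal (√(C * 76800) * M)) ENNReal.ofReal_ne_top (fun φ ψ => ?_) hc' hU hV
  · calc _ ≤ _ := mul_le_mul_right h _
      _ = _ := by
        rw [mul_assoc √_, ENNReal.ofReal_mul (p := √((2 * Real.pi) ^ 3)) (by positivity),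
          mul_assoc (ENNReal.ofReal √_), mul_assoc (ENNReal.ofReal √_), mul_pow (ENNReal.ofReal √_),
          ← ENNReal.ofReal_pow (by positivity), Real.sq_sqrt (by positivity)]
  · refine (hfree _ _ _ σ₁ σ₂ _ (card_resonant_separated_le hM hMN hσ₁ hσ₂) _ _).trans_eq ?_
    rw [sum_norm_sq_extend, sum_norm_sq_extend, ← ofReal_norm, ← ofReal_norm,
      ← ENNReal.ofReal_mul (by positivity), ← ENNReal.ofReal_mul (by positivity),
      ← ENNReal.ofReal_pow (by positivity), mul_pow, mul_pow, mul_pow,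
      Real.sq_sqrt (by positivity)]
    ring_nf

theorem lintegral_sum_sq_le {α ι : Type*} [MeasurableSpace α] {μ : Measure α} (s : Finset ι)
    {g : ι → α → ℝ≥0∞} (hg : ∀ i, Measurable (g i)) {b : ι → ℝ≥0∞}
    (hb : ∀ i ∈ s, ∫⁻ x, g i x ^ 2 ∂μ ≤ b i ^ 2) :
    ∫⁻ x, (∑ i ∈ s, g i x) ^ 2 ∂μ ≤ (∑ i ∈ s, b i) ^ 2 := by
  have hnorm : ∀ f : α → ℝ≥0∞, eLpNorm f 2 μ ^ 2 = ∫⁻ x, f x ^ 2 ∂μ := by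
    intro f
    rw [eLpNorm_eq_lintegral_rpow_enorm_toReal (by norm_num) (by norm_num), ENNReal.toReal_ofNat,
      ← ENNReal.rpow_natCast, ← ENNReal.rpow_mul]
    norm_num
  have h := eLpNorm_sum_le (μ := μ) (p := 2) (f := g) (s := s)
    (fun i _ => (hg i).aestronglyMeasurable) one_le_two
  have h2 : ∀ i ∈ s, eLpNorm (g i) 2 μ ≤ b i := fun i hi => by
    rw [← ENNReal.pow_le_pow_left_iff two_ne_zero, hnorm]
    exact hb i hi
  have h3 := pow_le_pow_left₀ zero_le (h.trans (Finset.sum_le_sum h2)) 2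
  rw [hnorm] at h3
  simpa only [Finset.sum_apply] using h3

theorem trigPoly_add (S : Finset (Fin 3 → ℤ)) (a b : (Fin 3 → ℤ) → ℂ) :
    trigPoly S (a + b) = trigPoly S a + trigPoly S b := by
  rw [trigPoly, trigPoly, trigPoly, ← Finset.sum_add_distrib]
  exact Finset.sum_congr rfl fun m _ => add_smul _ _ _

theorem trigPoly_smul (S : Finset (Fin 3 → ℤ)) (z : ℂ) (a : (Fin 3 → ℤ) → ℂ) :
    trigPoly S (z • a) = z • trigPoly S a := by
  rw [trigPoly, trigPoly, Finset.smul_sum]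
  exact Finset.sum_congr rfl fun m _ => mul_smul z (a m) _

instance fact_one_le_four_ennreal : Fact ((1 : ℝ≥0∞) ≤ 4) := ⟨by norm_num⟩

/-- The decomposition of a trigonometric polynomial into frequency blocks, in `ℓ² L⁴`. -/
noncomputable def blockMap (S : Finset (Fin 3 → ℤ)) (q : (Fin 3 → ℤ) → Fin 3 → ℤ) :
    ((Fin 3 → ℤ) → ℂ) →ₗ[ℂ]
      PiLp 2 fun _ : ↥(S.image q) => Lp ℂ 4 ((volume : Measure (Fin 3 → ℝ)).restrict cube) where
  toFun a := WithLp.toLp 2 fun Q => trigPoly (S.filter fun m => q m = Q) a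
  map_add' a b := (congrArg (WithLp.toLp 2) (funext fun _ => trigPoly_add _ a b)).trans
    (WithLp.toLp_add 2 _ _)
  map_smul' z a := (congrArg (WithLp.toLp 2) (funext fun _ => trigPoly_smul _ z a)).trans
    (WithLp.toLp_smul 2 z _)

theorem enorm_blockMap_sq (S : Finset (Fin 3 → ℤ)) (q : (Fin 3 → ℤ) → Fin 3 → ℤ)
    (a : (Fin 3 → ℤ) → ℂ) :
    ‖blockMap S q a‖ₑ ^ 2 =
      ∑ Q ∈ S.image q, ‖trigPoly (S.filter fun m => q m = Q) a‖ₑ ^ 2 := by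
  rw [blockMap, LinearMap.coe_mk, AddHom.coe_mk, enorm_toLp_sq]
  exact Finset.sum_coe_sort (S.image q) fun Q => ‖trigPoly (S.filter fun m => q m = Q) a‖ₑ ^ 2

theorem blockMap_congr (S : Finset (Fin 3 → ℤ)) (q : (Fin 3 → ℤ) → Fin 3 → ℤ)
    {a b : (Fin 3 → ℤ) → ℂ} (h : ∀ m ∈ S, a m = b m) : blockMap S q a = blockMap S q b := by
  rw [blockMap, LinearMap.coe_mk, AddHom.coe_mk]
  congr 1
  ext1 Q
  exact Finset.sum_congr rfl fun m hm => by rw [h m (Finset.mem_filter.1 hm).1]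

theorem measurable_enorm_trigPoly (S : Finset (Fin 3 → ℤ)) {a : (Fin 3 → ℤ) → ℝ → ℂ}
    (ha : ∀ m, Measurable (a m)) : Measurable fun t => ‖trigPoly S fun m => a m t‖ₑ := by
  unfold trigPoly
  exact (Finset.stronglyMeasurable_fun_sum _ fun m _ =>
    (ha m).stronglyMeasurable.smul_const _).enorm

theorem measurable_enorm_blockMap (S : Finset (Fin 3 → ℤ)) (q : (Fin 3 → ℤ) → Fin 3 → ℤ)
    {a : (Fin 3 → ℤ) → ℝ → ℂ} (ha : ∀ m, Measurable (a m)) :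
    Measurable fun t => ‖blockMap S q fun m => a m t‖ₑ := by
  have h : ∀ a, ‖blockMap S q a‖ₑ =
      (∑ Q ∈ S.image q, ‖trigPoly (S.filter fun m => q m = Q) a‖ₑ ^ 2) ^ (1 / (2 : ℝ)) := by
    intro a
    rw [← enorm_blockMap_sq, ← ENNReal.rpow_natCast, ← ENNReal.rpow_mul]
    norm_num
  simp only [h]
  exact (Finset.measurable_fun_sum _ fun Q _ =>
    (measurable_enorm_trigPoly _ ha).pow_const 2).pow_const _

/-- Strichartz estimate in `ℓ² L⁴` for free half-waves, in terms of the number of resonant pairs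
within each frequency block. -/
theorem exists_lintegral_blockMap_freeWave_le (T : ℝ) : ∃ C > (0 : ℝ),
    ∀ (S : Finset (Fin 3 → ℤ)) (q : (Fin 3 → ℤ) → Fin 3 → ℤ) (σ K : ℝ),
      (∀ Q k τ, (((S.filter fun m => q m = Q).filter fun m =>
        k - m ∈ S.filter (fun m => q m = Q) ∧
          |σ * jbZ m + σ * jbZ (k - m) - τ| ≤ 1).card : ℝ) ≤ K) →
      ∀ φ, ∫⁻ t in Set.Icc 0 T, ‖blockMap S q (freeWave S σ t φ)‖ₑ ^ 4 ≤
        (ENNReal.ofReal √√(C * K) * ‖φ‖ₑ) ^ 4 := by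
  obtain ⟨C, hC, hfree⟩ := exists_lintegral_coeffConv_free_le T
  refine ⟨(2 * Real.pi) ^ 3 * C, by positivity, fun S q σ K hK φ => ?_⟩
  have hK0 : 0 ≤ K := (Nat.cast_nonneg _).trans (hK 0 0 0)
  set a : (Fin 3 → ℤ) → ℂ := fun m => if h : m ∈ S then φ ⟨m, h⟩ else 0 with ha
  set B : (Fin 3 → ℤ) → Finset (Fin 3 → ℤ) := fun Q => S.filter fun m => q m = Q with hB
  have hmeas : ∀ Q, Measurable fun t => ‖trigPoly (B Q) (freeWave S σ t φ)‖ₑ ^ 2 := fun Q =>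
    (measurable_enorm_trigPoly (B Q) fun m => (continuous_freeWave S σ φ m).measurable).pow_const 2
  have hblock : ∀ Q ∈ S.image q,
      ∫⁻ t in Set.Icc 0 T, (‖trigPoly (B Q) (freeWave S σ t φ)‖ₑ ^ 2) ^ 2 ≤
        ENNReal.ofReal (√((2 * Real.pi) ^ 3 * C * K) * ∑ m ∈ B Q, ‖a m‖ ^ 2) ^ 2 := by
    intro Q _
    set Z := (B Q ×ˢ B Q).image fun p => p.1 + p.2 with hZ
    have hsub : ∀ m ∈ B Q, ∀ n ∈ B Q, m + n ∈ Z := fun m hm n hn =>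
      Finset.mem_image.2 ⟨(m, n), Finset.mem_product.2 ⟨hm, hn⟩, rfl⟩
    simp only [← pow_mul]
    simp only [show 2 * 2 = 4 from rfl, enorm_trigPoly_pow_four_eq (B Q) Z _ hsub]
    rw [lintegral_const_mul' _ _ ENNReal.ofReal_ne_top]
    refine (mul_le_mul_right (hfree (B Q) (B Q) Z σ σ K (hK Q) a a) _).trans_eq ?_
    rw [← ENNReal.ofReal_pow (by positivity), ← ENNReal.ofReal_mul (by positivity),
      mul_pow √_, Real.sq_sqrt (by positivity)]
    ring_nf
  have h4 : ∀ y : ℝ≥0∞, y ^ 4 = (y ^ 2) ^ 2 := fun y => by rw [← pow_mul]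
  simp only [h4, enorm_blockMap_sq]
  refine (lintegral_sum_sq_le (S.image q) hmeas hblock).trans_eq ?_
  rw [← ENNReal.ofReal_sum_of_nonneg fun _ _ => by positivity, ← Finset.mul_sum,
    Finset.sum_fiberwise_of_maps_to (fun m hm => Finset.mem_image_of_mem q hm),
    sum_norm_sq_extend, ← ofReal_norm, ← ENNReal.ofReal_mul (by positivity),
    ← ENNReal.ofReal_pow (by positivity), mul_pow, Real.sq_sqrt (by positivity),
    ← ENNReal.ofReal_pow (by positivity), ← ENNReal.ofReal_pow (by positivity), mul_pow √√_,
    Real.sq_sqrt (by positivity), mul_pow √_, Real.sq_sqrt (by positivity)]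

theorem coeffConvBilin_eq_sum_blocks (S S' Z W : Finset (Fin 3 → ℤ))
    (q : (Fin 3 → ℤ) → Fin 3 → ℤ)
    (hW : ∀ m ∈ S, ∀ n ∈ S', m + n ∈ Z → q m + q n ∈ W) (a b : (Fin 3 → ℤ) → ℂ) :
    coeffConvBilin S S' Z a b = ∑ e ∈ W, ∑ Q ∈ S.image q,
      coeffConvBilin (S.filter fun m => q m = Q) (S'.filter fun n => q n = e - Q) Z a b := by
  ext ⟨k, hk⟩
  simp only [WithLp.ofLp_sum, Finset.sum_apply]
  simp only [coeffConvBilin, LinearMap.mk₂_apply, coeffConv]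
  have h1 : ∀ e ∈ W, (∑ Q ∈ S.image q, ∑ m ∈ S.filter (fun m => q m = Q),
      ∑ n ∈ S'.filter (fun n => q n = e - Q), if m + n = k then a m * b n else 0) =
      ∑ m ∈ S, ∑ n ∈ S', if q m + q n = e then (if m + n = k then a m * b n else 0) else 0 := by
    intro e _
    rw [← Finset.sum_fiberwise_of_maps_to (fun m hm => Finset.mem_image_of_mem q hm)
      (fun m => ∑ n ∈ S', if q m + q n = e then (if m + n = k then a m * b n else 0) else 0)]
    refine Finset.sum_congr rfl fun Q _ => Finset.sum_congr rfl fun m hm => ?_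
    rw [Finset.sum_filter]
    refine Finset.sum_congr rfl fun n _ => ?_
    simp only [(Finset.mem_filter.1 hm).2, eq_sub_iff_add_eq, add_comm (q n) Q]
  refine Eq.trans ?_ (Finset.sum_congr rfl h1).symm
  conv_rhs => rw [Finset.sum_comm]
  refine Finset.sum_congr rfl fun m hm => ?_
  conv_rhs => rw [Finset.sum_comm]
  refine Finset.sum_congr rfl fun n hn => ?_
  rw [Finset.sum_ite_eq]
  by_cases hmn : m + n = k
  · rw [if_pos (hW m hm n hn (hmn ▸ hk))]
  · simp only [hmn, if_false, ite_self]

theorem sum_enorm_trigPoly_mul_le (S S' : Finset (Fin 3 → ℤ)) (q : (Fin 3 → ℤ) → Fin 3 → ℤ)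
    (e : Fin 3 → ℤ) (a b : (Fin 3 → ℤ) → ℂ) :
    ∑ Q ∈ S.image q, ‖trigPoly (S.filter fun m => q m = Q) a‖ₑ *
        ‖trigPoly (S'.filter fun n => q n = e - Q) b‖ₑ ≤
      ‖blockMap S q a‖ₑ * ‖blockMap S' q b‖ₑ := by
  refine (ENNReal.inner_le_Lp_mul_Lq _ _ _ Real.HolderConjugate.two_two).trans ?_
  have hroot : ∀ y : ℝ≥0∞, (y ^ 2) ^ (1 / (2 : ℝ)) = y := fun y => by
    rw [← ENNReal.rpow_natCast, ← ENNReal.rpow_mul]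
    norm_num
  simp only [ENNReal.rpow_ofNat]
  rw [← enorm_blockMap_sq, hroot]
  gcongr
  rw [← hroot ‖blockMap S' q b‖ₑ, enorm_blockMap_sq]
  gcongr
  rw [← Finset.sum_image (f := fun R => ‖trigPoly (S'.filter fun n => q n = R) b‖ₑ ^ 2)
    (g := fun Q => e - Q) fun x _ y _ hxy => sub_right_injective hxy]
  refine Finset.sum_le_sum_of_ne_zero fun R _ hR => ?_
  by_contra hRS
  refine hR ?_
  rw [Finset.filter_eq_empty_iff.2 fun n hn hqn => hRS (Finset.mem_image.2 ⟨n, hn, hqn⟩), trigPoly,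
    Finset.sum_empty, enorm_zero, zero_pow two_ne_zero]

/-- Almost orthogonality of frequency blocks. -/
theorem sum_coeffConv_sq_le_blockMap (S S' Z W : Finset (Fin 3 → ℤ))
    (q : (Fin 3 → ℤ) → Fin 3 → ℤ)
    (hW : ∀ m ∈ S, ∀ n ∈ S', m + n ∈ Z → q m + q n ∈ W) (a b : (Fin 3 → ℤ) → ℂ) :
    ENNReal.ofReal ((2 * Real.pi) ^ 3) * ∑ k ∈ Z, ‖coeffConv S S' a b k‖ₑ ^ 2 ≤
      (W.card * (‖blockMap S q a‖ₑ * ‖blockMap S' q b‖ₑ)) ^ 2 := by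
  set v := ENNReal.ofReal √((2 * Real.pi) ^ 3) with hv
  have hv2 : ENNReal.ofReal ((2 * Real.pi) ^ 3) = v ^ 2 := by
    rw [hv, ← ENNReal.ofReal_pow (by positivity), Real.sq_sqrt (by positivity)]
  rw [← enorm_coeffConvBilin_sq, hv2, ← mul_pow]
  refine pow_le_pow_left₀ zero_le ?_ 2
  rw [coeffConvBilin_eq_sum_blocks S S' Z W q hW, ← nsmul_eq_mul]
  calc v * _ ≤ v * ∑ e ∈ W, ∑ Q ∈ S.image q, ‖coeffConvBilin (S.filter fun m => q m = Q)
          (S'.filter fun n => q n = e - Q) Z a b‖ₑ := by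
        gcongr
        exact (enorm_sum_le _ _).trans (Finset.sum_le_sum fun e _ => enorm_sum_le _ _)
    _ = ∑ e ∈ W, ∑ Q ∈ S.image q, v * ‖coeffConvBilin (S.filter fun m => q m = Q)
          (S'.filter fun n => q n = e - Q) Z a b‖ₑ := by
        simp only [Finset.mul_sum]
    _ ≤ ∑ e ∈ W, ∑ Q ∈ S.image q, ‖trigPoly (S.filter fun m => q m = Q) a‖ₑ *
          ‖trigPoly (S'.filter fun n => q n = e - Q) b‖ₑ := by
        refine Finset.sum_le_sum fun e _ => Finset.sum_le_sum fun Q _ => ?_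
        rw [← ENNReal.pow_le_pow_left_iff two_ne_zero, mul_pow, mul_pow, ← hv2,
          enorm_coeffConvBilin_sq]
        exact sum_coeffConv_sq_le _ _ _ _ _
    _ ≤ ∑ e ∈ W, ‖blockMap S q a‖ₑ * ‖blockMap S' q b‖ₑ :=
        Finset.sum_le_sum fun e _ => sum_enorm_trigPoly_mul_le S S' q e a b
    _ = _ := Finset.sum_const _

/-- The index of the cube of side length `ℓ` containing a lattice point. -/
noncomputable def gridIndex (ℓ : ℝ) (m : Fin 3 → ℤ) : Fin 3 → ℤ := fun i => ⌊(m i : ℝ) / ℓ⌋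

theorem norm_latticeVec_sub_le_of_gridIndex_eq {ℓ : ℝ} (hℓ : 0 < ℓ) {m n : Fin 3 → ℤ}
    (h : gridIndex ℓ m = gridIndex ℓ n) : ‖latticeVec m - latticeVec n‖ ≤ 2 * ℓ := by
  have hi : ∀ i, ((m - n) i : ℝ) ^ 2 ≤ ℓ ^ 2 := fun i => by
    have h1 := Int.abs_sub_lt_one_of_floor_eq_floor (congrFun h i)
    rw [← sub_div, abs_div, abs_of_pos hℓ, div_lt_one hℓ] at h1
    rw [Pi.sub_apply, Int.cast_sub, ← sq_abs]
    exact pow_le_pow_left₀ (abs_nonneg _) h1.le 2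
  rw [← latticeVec_sub, norm_latticeVec, normZ]
  refine Real.sqrt_le_iff.2 ⟨by positivity, ?_⟩
  rw [Fin.sum_univ_three]
  nlinarith [hi 0, hi 1, hi 2]

theorem abs_apply_le_normZ (k : Fin 3 → ℤ) (i : Fin 3) : |(k i : ℝ)| ≤ normZ k :=
  Real.abs_le_sqrt (Finset.single_le_sum (f := fun i => (k i : ℝ) ^ 2)
    (fun _ _ => sq_nonneg _) (Finset.mem_univ i))

theorem gridIndex_add_mem {O : ℝ} (hO : 1 ≤ O) {m n : Fin 3 → ℤ} (h : m + n ∈ annulus O) :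
    gridIndex (O / 8) m + gridIndex (O / 8) n ∈
      Finset.Icc (fun _ : Fin 3 => (-18 : ℤ)) fun _ => 16 := by
  have hi : ∀ i, -18 ≤ (gridIndex (O / 8) m + gridIndex (O / 8) n) i ∧
      (gridIndex (O / 8) m + gridIndex (O / 8) n) i ≤ 16 := fun i => by
    have h0 := (mem_annulus_iff h).2
    rw [norm_latticeVec] at h0
    have h1 := abs_lt.1 ((abs_apply_le_normZ _ i).trans_lt h0)
    rw [Pi.add_apply, Int.cast_add] at h1
    have h2 : -16 < (m i : ℝ) / (O / 8) + n i / (O / 8) := by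
      rw [← add_div, lt_div_iff₀ (by positivity)]
      linarith
    have h3 : (m i : ℝ) / (O / 8) + n i / (O / 8) < 16 := by
      rw [← add_div, div_lt_iff₀ (by positivity)]
      linarith
    have h4 := Int.floor_le ((m i : ℝ) / (O / 8))
    have h5 := Int.floor_le ((n i : ℝ) / (O / 8))
    have h6 := Int.lt_floor_add_one ((m i : ℝ) / (O / 8))
    have h7 := Int.lt_floor_add_one ((n i : ℝ) / (O / 8))
    simp only [Pi.add_apply, gridIndex]
    constructor
    · have : ((-19 : ℤ) : ℝ) < ((⌊(m i : ℝ) / (O / 8)⌋ + ⌊(n i : ℝ) / (O / 8)⌋ : ℤ) : ℝ) := by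
        push_cast
        linarith
      have := Int.cast_lt.1 this
      omega
    · have : ((⌊(m i : ℝ) / (O / 8)⌋ + ⌊(n i : ℝ) / (O / 8)⌋ : ℤ) : ℝ) < ((17 : ℤ) : ℝ) := by
        push_cast
        linarith
      have := Int.cast_lt.1 this
      omega
  rw [Finset.mem_Icc]
  exact ⟨fun i => (hi i).1, fun i => (hi i).2⟩

theorem card_resonant_gridIndex_le {R N O : ℝ} (hN : 1 ≤ N) (hNR : N ≤ R) (hO : 1 ≤ O)
    (hON : O ≤ 6 * N) {σ : ℝ} (hσ : σ = 1 ∨ σ = -1) (Q k : Fin 3 → ℤ) (τ : ℝ) :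
    ((((annulus N).filter fun m => gridIndex (O / 8) m = Q).filter fun m =>
      k - m ∈ (annulus N).filter (fun m => gridIndex (O / 8) m = Q) ∧
        |σ * jbZ m + σ * jbZ (k - m) - τ| ≤ 1).card : ℝ) ≤ 48000 * R * O := by
  refine (card_resonant_diam_le (d := O / 4) hN (by positivity) (by linarith) _
    (Finset.filter_subset _ _) (fun m hm n hn => ?_) hσ k τ).trans ?_
  · refine (norm_latticeVec_sub_le_of_gridIndex_eq (ℓ := O / 8) (by positivity) ?_).trans_eq
      (by ring)
    rw [(Finset.mem_filter.1 hm).2, (Finset.mem_filter.1 hn).2]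
  · nlinarith

theorem lintegral_blockMap_le_UpNorm (T : ℝ) (S : Finset (Fin 3 → ℤ))
    (q : (Fin 3 → ℤ) → Fin 3 → ℤ) (σ : ℝ) {A : ℝ≥0∞} (hA : A ≠ ⊤)
    (hfree : ∀ φ, ∫⁻ t in Set.Icc 0 T, ‖blockMap S q (freeWave S σ t φ)‖ₑ ^ 4 ≤ (A * ‖φ‖ₑ) ^ 4)
    {c : (Fin 3 → ℤ) → ℝ → ℂ} (hU : UpNorm 4 (modCurve S σ c) ≠ ⊤) :
    ∫⁻ t in Set.Icc 0 T, ‖blockMap S q fun m => c m t‖ₑ ^ 4 ≤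
      (A * UpNorm 4 (modCurve S σ c)) ^ 4 := by
  have h := lintegral_map_le_UpNorm (p := 4) (by norm_num) (volume.restrict (Set.Icc 0 T))
    (fun t => (blockMap S q).comp (freeWave S σ t))
    (fun φ => measurable_enorm_blockMap S q (a := fun m t => freeWave S σ t φ m)
      fun m => (continuous_freeWave S σ φ m).measurable)
    hA (by simpa only [ENNReal.rpow_ofNat, LinearMap.comp_apply] using hfree) hU
  simp only [ENNReal.rpow_ofNat, LinearMap.comp_apply] at h
  refine le_trans (le_of_eq ?_) h
  refine lintegral_congr fun t => ?_
  rw [blockMap_congr S q fun m hm => (freeWave_modCurve S σ t c hm).symm]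

/-- Bilinear estimate in `U⁴` for comparable frequency scales. -/
theorem exists_eLpNorm_projProd_comparable_le (T : ℝ) : ∃ C > (0 : ℝ), ∀ M N O : ℝ, 1 ≤ M →
    1 ≤ N → 1 ≤ O → ∀ σ₁ σ₂ : ℝ, (σ₁ = 1 ∨ σ₁ = -1) → (σ₂ = 1 ∨ σ₂ = -1) →
    ∀ c c' : (Fin 3 → ℤ) → ℝ → ℂ, (∀ m, Measurable (c m)) → (∀ n, Measurable (c' n)) →
    N / 2 ≤ M → M ≤ 2 * N →
      eLpNorm (fun p : ℝ × (Fin 3 → ℝ) => projProd O M N c c' p.1 p.2)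
          2 (volume.restrict (Set.Icc 0 T ×ˢ cube)) ≤
        ENNReal.ofReal (C * max O (max M N) ^ ((1 : ℝ) / 2) * min O (min M N) ^ ((1 : ℝ) / 2)) *
          UpNorm 4 (modCurve (annulus M) σ₁ c) * UpNorm 4 (modCurve (annulus N) σ₂ c') := by
  obtain ⟨C, hC, hfree⟩ := exists_lintegral_blockMap_freeWave_le T
  set W := Finset.Icc (fun _ : Fin 3 => (-18 : ℤ)) fun _ => 16 with hW
  have hWcard : (0 : ℝ) < W.card :=
    Nat.cast_pos.2 (Finset.card_pos.2 (Finset.nonempty_Icc.2 fun _ => by norm_num))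
  refine ⟨W.card * √(C * 288000), by positivity,
    fun M N O hM hN hO σ₁ σ₂ hσ₁ hσ₂ c c' hc hc' hNM hMN => ?_⟩
  rcases lt_or_ge (6 * min M N) O with hO6 | hO6
  · rw [eLpNorm_projProd_eq_zero _ fun t k hk => coeffConv_eq_zero (fun m hm n hn hmn => ?_) _ _]
    · exact zero_le
    · have h1 := mem_annulus_iff hk
      have h2 := mem_annulus_iff hm
      have h3 := mem_annulus_iff hn
      have h4 := norm_add_le (latticeVec m) (latticeVec n)
      rw [← latticeVec_add, hmn] at h4
      rcases le_total M N with h | h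
      · rw [min_eq_left h] at hO6
        linarith
      · rw [min_eq_right h] at hO6
        linarith
  have hOM : O ≤ 6 * M := hO6.trans (by linarith [min_le_left M N])
  have hON : O ≤ 6 * N := hO6.trans (by linarith [min_le_right M N])
  have hmax : 1 ≤ max O (max M N) := hO.trans (le_max_left _ _)
  have hmin : 1 ≤ min O (min M N) := le_min hO (le_min hM hN)
  set R := max O (max M N) with hR
  set r := min O (min M N) with hr
  have hOr : O ≤ 6 * r := by
    rcases min_choice O (min M N) with h | h <;> rw [← hr] at h <;> linarith
  have hMR : M ≤ R := (le_max_left M N).trans (le_max_right _ _)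
  have hNR : N ≤ R := (le_max_right M N).trans (le_max_right _ _)
  rw [← Real.sqrt_eq_rpow, ← Real.sqrt_eq_rpow]
  refine eLpNorm_projProd_le_of_ne_top (by norm_num) T (by positivity) hc hc' fun hU hV => ?_
  set q := gridIndex (O / 8)
  set A := ENNReal.ofReal √√(C * (48000 * R * O)) with hA
  set U := UpNorm 4 (modCurve (annulus M) σ₁ c)
  set V := UpNorm 4 (modCurve (annulus N) σ₂ c')
  have hcU : ∫⁻ t in Set.Icc 0 T, ‖blockMap (annulus M) q fun m => c m t‖ₑ ^ 4 ≤ (A * U) ^ 4 :=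
    lintegral_blockMap_le_UpNorm T _ q σ₁ ENNReal.ofReal_ne_top
      (hfree _ q σ₁ _ (card_resonant_gridIndex_le hM hMR hO hOM hσ₁)) hU
  have hcV : ∫⁻ t in Set.Icc 0 T, ‖blockMap (annulus N) q fun n => c' n t‖ₑ ^ 4 ≤ (A * V) ^ 4 :=
    lintegral_blockMap_le_UpNorm T _ q σ₂ ENNReal.ofReal_ne_top
      (hfree _ q σ₂ _ (card_resonant_gridIndex_le hN hNR hO hON hσ₂)) hV
  have hroot : ∀ y : ℝ≥0∞, (y ^ 4) ^ (1 / (2 : ℝ)) = y ^ 2 := fun y => by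
    rw [← ENNReal.rpow_natCast, ← ENNReal.rpow_mul, ← ENNReal.rpow_natCast]
    norm_num
  have hA2 : W.card * A ^ 2 ≤ ENNReal.ofReal (W.card * √(C * 288000) * √R * √r) := by
    rw [hA, ← ENNReal.ofReal_pow (by positivity), Real.sq_sqrt (by positivity),
      ← ENNReal.ofReal_natCast, ← ENNReal.ofReal_mul (by positivity), mul_assoc (_ * _) √R,
      ← Real.sqrt_mul (by positivity), mul_assoc (W.card : ℝ), ← Real.sqrt_mul (by positivity)]
    gcongr ENNReal.ofReal (_ * √?_)
    nlinarith [mul_le_mul_of_nonneg_left hOr (show 0 ≤ C * R by positivity)]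
  have hmeasU := measurable_enorm_blockMap (annulus M) q hc
  have hmeasV := measurable_enorm_blockMap (annulus N) q hc'
  calc _ = ∫⁻ t in Set.Icc 0 T, ENNReal.ofReal ((2 * Real.pi) ^ 3) * ∑ k ∈ annulus O,
        ‖coeffConv (annulus M) (annulus N) (fun m => c m t) (fun n => c' n t) k‖ₑ ^ 2 :=
        (lintegral_const_mul' _ _ ENNReal.ofReal_ne_top).symm
    _ ≤ ∫⁻ t in Set.Icc 0 T, (W.card : ℝ≥0∞) ^ 2 * (‖blockMap (annulus M) q fun m => c m t‖ₑ ^ 2 *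
        ‖blockMap (annulus N) q fun n => c' n t‖ₑ ^ 2) := by
        refine lintegral_mono fun t => ?_
        rw [← mul_pow, ← mul_pow]
        exact sum_coeffConv_sq_le_blockMap _ _ _ W q
          (fun m _ n _ hmn => gridIndex_add_mem hO hmn) _ _
    _ = (W.card : ℝ≥0∞) ^ 2 * ∫⁻ t in Set.Icc 0 T, ‖blockMap (annulus M) q fun m => c m t‖ₑ ^ 2 *
        ‖blockMap (annulus N) q fun n => c' n t‖ₑ ^ 2 :=
        lintegral_const_mul' _ _ (ENNReal.pow_ne_top (ENNReal.natCast_ne_top _))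
    _ ≤ (W.card : ℝ≥0∞) ^ 2 * ((A * U) ^ 2 * (A * V) ^ 2) := by
        gcongr
        refine (ENNReal.lintegral_mul_le_Lp_mul_Lq _ Real.HolderConjugate.two_two
          (hmeasU.pow_const 2).aemeasurable (hmeasV.pow_const 2).aemeasurable).trans ?_
        rw [← hroot (A * U), ← hroot (A * V)]
        simp only [ENNReal.rpow_ofNat, ← pow_mul]
        gcongr
    _ = (W.card * A ^ 2 * U * V) ^ 2 := by ring
    _ ≤ _ := by gcongr

/-- **Bilinear estimate in adapted atomic spaces** (Proposition 5.3).
For every `T > 0` there is a constant `C_T > 0` such that for all `M, N, O ≥ 1`,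
all signs `σ₁, σ₂ ∈ {+1, -1}`, and all frequency-localized space-time functions `u` at scale
`M` (with coefficients `c`) and `v` at scale `N` (with coefficients `c'`):
(i) if `4M ≤ N` then
`‖P_O(uv)‖_{L²([0,T]×T³)} ≤ C_T min(O,M,N) ‖u‖_{U²_{σ₁}} ‖v‖_{U²_{σ₂}}`;
(ii) if `N/2 ≤ M ≤ 2N` then
`‖P_O(uv)‖_{L²([0,T]×T³)} ≤ C_T max(O,M,N)^{1/2} min(O,M,N)^{1/2} ‖u‖_{U⁴_{σ₁}} ‖v‖_{U⁴_{σ₂}}`. -/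
theorem bilinear_estimate_adapted_spaces (T : ℝ) (hT : 0 < T) :
    ∃ C > (0:ℝ), ∀ M N O : ℝ, 1 ≤ M → 1 ≤ N → 1 ≤ O →
      ∀ σ₁ σ₂ : ℝ, (σ₁ = 1 ∨ σ₁ = -1) → (σ₂ = 1 ∨ σ₂ = -1) →
      ∀ c c' : (Fin 3 → ℤ) → ℝ → ℂ,
        (∀ m, Measurable (c m)) → (∀ n, Measurable (c' n)) →
        (4 * M ≤ N →
          eLpNorm (fun p : ℝ × (Fin 3 → ℝ) => projProd O M N c c' p.1 p.2)
              2 (volume.restrict (Set.Icc 0 T ×ˢ cube)) ≤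
            ENNReal.ofReal (C * min O (min M N)) *
              UpNorm 2 (modCurve (annulus M) σ₁ c) * UpNorm 2 (modCurve (annulus N) σ₂ c')) ∧
        (N / 2 ≤ M → M ≤ 2 * N →
          eLpNorm (fun p : ℝ × (Fin 3 → ℝ) => projProd O M N c c' p.1 p.2)
              2 (volume.restrict (Set.Icc 0 T ×ˢ cube)) ≤
            ENNReal.ofReal (C * max O (max M N) ^ ((1:ℝ)/2) * min O (min M N) ^ ((1:ℝ)/2)) *
              UpNorm 4 (modCurve (annulus M) σ₁ c) * UpNorm 4 (modCurve (annulus N) σ₂ c')) := by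
  obtain ⟨C₁, hC₁, h₁⟩ := exists_eLpNorm_projProd_separated_le T
  obtain ⟨C₂, hC₂, h₂⟩ := exists_eLpNorm_projProd_comparable_le T
  refine ⟨max C₁ C₂, lt_max_of_lt_left hC₁,
    fun M N O hM hN hO σ₁ σ₂ hσ₁ hσ₂ c c' hc hc' => ⟨fun hMN => ?_, fun hNM hMN => ?_⟩⟩
  · refine (h₁ M N O hM hN hO σ₁ σ₂ hσ₁ hσ₂ c c' hc hc' hMN).trans ?_
    gcongr
    exact le_max_left _ _
  · refine (h₂ M N O hM hN hO σ₁ σ₂ hσ₁ hσ₂ c c' hc hc' hNM hMN).trans ?_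
    gcongr
    exact le_max_right _ _
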